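/- Let s ∈ (0,1), a = 1 − 2s, and let f : ℝ → ℝ be of class C^{1,γ} for some γ > max(0, 1−2s). Let u be a layer solution of the extension problem in the half-plane ℝ × (0,∞). Then for every y ≥ 0 and every x ∈ ℝ one has the strict inequality (1+a) ∫₀^y (1/2) t^a ( (∂ₓu(x,t))² − (∂_y u(x,t))² ) dt < G(u(x,0)) − G(1). -/

import Mathlib

open Real MeasureTheory Filter Set

/-- Normalizing constant of the one-dimensional fractional Laplacian. -/
noncomputable def fracLapCoef (s : ℝ) : ℝ :=
  (4:ℝ) ^ s * s * Real.Gamma (s + 1/2) / (Real.sqrt π * Real.Gamma (1 - s))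

/-- The one-dimensional fractional Laplacian `(-∂ₓₓ)^s v (x)`. -/
noncomputable def fracLap (s : ℝ) (v : ℝ → ℝ) (x : ℝ) : ℝ :=
  fracLapCoef s * ∫ y in Set.Ioi (0:ℝ), (2 * v x - v (x + y) - v (x - y)) * y ^ (-1 - 2*s)

/-- `f` is of class `C^{1,γ}`: continuously differentiable with `γ`-Hölder derivative. -/
def IsC1Holder (γ : ℝ) (f : ℝ → ℝ) : Prop :=
  ContDiff ℝ 1 f ∧ ∃ C : ℝ, ∀ x y : ℝ, |deriv f x - deriv f y| ≤ C * |x - y| ^ γ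

/-- A layer solution of `(-∂ₓₓ)^s v = f(v)` in `ℝ`. -/
structure IsLayerSolution (s : ℝ) (f : ℝ → ℝ) (v : ℝ → ℝ) : Prop where
  bounded : ∃ M : ℝ, ∀ x, |v x| ≤ M
  smooth : ContDiff ℝ 2 v
  eqn : ∀ x, fracLap s v x = f (v x)
  mono : ∀ x, 0 < deriv v x
  limNeg : Tendsto v atBot (nhds (-1))
  limPos : Tendsto v atTop (nhds 1)

/-- The potential `G(r) = -∫₀^r f`. -/
noncomputable def potG (f : ℝ → ℝ) (r : ℝ) : ℝ := -∫ u in (0:ℝ)..r, f u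
/-- A bounded solution of the extension problem in the half-plane `ℝ × (0,∞)`.
`u x y` denotes the value of the solution at `(x,y)`. -/
structure IsBoundedExtSolution1 (a : ℝ) (f : ℝ → ℝ) (u : ℝ → ℝ → ℝ) : Prop where
  bounded : ∃ M : ℝ, ∀ x y : ℝ, 0 ≤ y → |u x y| ≤ M
  cont : ContinuousOn (fun p : ℝ × ℝ => u p.1 p.2) {p : ℝ × ℝ | 0 ≤ p.2}
  smooth : ContDiffOn ℝ 2 (fun p : ℝ × ℝ => u p.1 p.2) {p : ℝ × ℝ | 0 < p.2}
  contDx : ContinuousOn (fun p : ℝ × ℝ => deriv (fun x' => u x' p.2) p.1) {p : ℝ × ℝ | 0 ≤ p.2}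
  eqn : ∀ x y : ℝ, 0 < y →
    y * (deriv (fun r => deriv (fun r' => u r' y) r) x
         + deriv (fun r => deriv (fun r' => u x r') r) y)
      + a * deriv (fun r => u x r) y = 0
  neumann : ∀ x : ℝ, Filter.Tendsto (fun y => -((1+a) * y ^ a * deriv (fun r => u x r) y))
      (nhdsWithin 0 (Set.Ioi 0)) (nhds (f (u x 0)))

/-- A layer solution of the extension problem in the half-plane. -/
structure IsLayerExtSolution1 (a : ℝ) (f : ℝ → ℝ) (u : ℝ → ℝ → ℝ)
    extends IsBoundedExtSolution1 a f u : Prop where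
  mono : ∀ x : ℝ, 0 < deriv (fun x' => u x' 0) x
  limNeg : Filter.Tendsto (fun x => u x 0) Filter.atBot (nhds (-1))
  limPos : Filter.Tendsto (fun x => u x 0) Filter.atTop (nhds 1)

/-- `φ` has first derivative `p` and second derivative `q` at `t`. -/
def SecD (φ : ℝ → ℝ) (t p q : ℝ) : Prop :=
  ∃ φ' : ℝ → ℝ, (∀ᶠ r in nhds t, HasDerivAt φ (φ' r) r) ∧ φ' t = p ∧ HasDerivAt φ' q t

lemma SecD.hasDerivAt {φ : ℝ → ℝ} {t p q : ℝ} (h : SecD φ t p q) : HasDerivAt φ p t := by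
  obtain ⟨φ', h1, h2, h3⟩ := h
  rw [← h2]; exact h1.self_of_nhds

lemma SecD.add {φ ψ : ℝ → ℝ} {t p q p' q' : ℝ} (h : SecD φ t p q) (h' : SecD ψ t p' q') :
    SecD (fun r => φ r + ψ r) t (p + p') (q + q') := by
  obtain ⟨φ', h1, h2, h3⟩ := h
  obtain ⟨ψ', k1, k2, k3⟩ := h'
  refine ⟨fun r => φ' r + ψ' r, ?_, by simp [h2, k2], h3.add k3⟩
  filter_upwards [h1, k1] with r a b using a.add b

lemma SecD.sub {φ ψ : ℝ → ℝ} {t p q p' q' : ℝ} (h : SecD φ t p q) (h' : SecD ψ t p' q') :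
    SecD (fun r => φ r - ψ r) t (p - p') (q - q') := by
  obtain ⟨φ', h1, h2, h3⟩ := h
  obtain ⟨ψ', k1, k2, k3⟩ := h'
  refine ⟨fun r => φ' r - ψ' r, ?_, by simp [h2, k2], h3.sub k3⟩
  filter_upwards [h1, k1] with r a b using a.sub b

lemma SecD.const_mul {φ : ℝ → ℝ} {t p q : ℝ} (c : ℝ) (h : SecD φ t p q) :
    SecD (fun r => c * φ r) t (c * p) (c * q) := by
  obtain ⟨φ', h1, h2, h3⟩ := h
  refine ⟨fun r => c * φ' r, ?_, by simp [h2], h3.const_mul c⟩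
  filter_upwards [h1] with r a using a.const_mul c

lemma SecD.const (c t : ℝ) : SecD (fun _ => c) t 0 0 :=
  ⟨fun _ => 0, Eventually.of_forall fun r => hasDerivAt_const r c, rfl, hasDerivAt_const t 0⟩

lemma SecD.comp_add {φ : ℝ → ℝ} {t p q : ℝ} (c : ℝ) (h : SecD φ (t + c) p q) :
    SecD (fun r => φ (r + c)) t p q := by
  obtain ⟨φ', h1, h2, h3⟩ := h
  refine ⟨fun r => φ' (r + c), ?_, h2, h3.comp_add_const t c⟩
  have : Tendsto (fun r => r + c) (nhds t) (nhds (t + c)) :=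
    (continuous_id.add continuous_const).tendsto t
  filter_upwards [this.eventually h1] with r hr using hr.comp_add_const r c

lemma SecD.comp_sub {φ : ℝ → ℝ} {t p q : ℝ} (c : ℝ) (h : SecD φ (c - t) p q) :
    SecD (fun r => φ (c - r)) t (-p) q := by
  obtain ⟨φ', h1, h2, h3⟩ := h
  refine ⟨fun r => -φ' (c - r), ?_, by simp [h2], ?_⟩
  · have : Tendsto (fun r => c - r) (nhds t) (nhds (c - t)) :=
      (continuous_const.sub continuous_id).tendsto t
    filter_upwards [this.eventually h1] with r hr
    exact hr.comp_const_sub c r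
  · have := (h3.comp_const_sub c t).neg
    rw [neg_neg] at this
    exact this

lemma SecD.max {φ : ℝ → ℝ} {t p q : ℝ} (h : SecD φ t p q) (hm : IsLocalMax φ t) :
    p = 0 ∧ q ≤ 0 := by
  have h0 : p = 0 := hm.hasDerivAt_eq_zero h.hasDerivAt
  refine ⟨h0, ?_⟩
  have hd := h.hasDerivAt
  obtain ⟨φ', h1, h2, h3⟩ := h
  by_contra hq
  push Not at hq
  have e1 : deriv φ =ᶠ[nhds t] φ' := by
    filter_upwards [h1] with r hr using hr.deriv
  have e2 : deriv (deriv φ) t = q := by rw [e1.deriv_eq]; exact h3.deriv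
  have hmin : IsLocalMin φ t := isLocalMin_of_deriv_deriv_pos (by rw [e2]; exact hq)
    (by rw [hd.deriv, h0]) hd.continuousAt
  have hc : φ =ᶠ[nhds t] fun _ => φ t := by
    filter_upwards [hm, hmin] with r ha hb using le_antisymm ha hb
  have : deriv (deriv φ) t = 0 := by
    rw [hc.deriv.deriv_eq]; simp
  linarith

lemma no_max {a y x : ℝ} {φ ψ : ℝ → ℝ} {p q p' q' : ℝ} (hy : 0 < y) (h : SecD φ x p q)
    (h' : SecD ψ y p' q') (hpos : 0 < y * (q + q') + a * p') :
    ¬ (IsLocalMax φ x ∧ IsLocalMax ψ y) := by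
  rintro ⟨h1, h2⟩
  obtain ⟨_, k1⟩ := h.max h1
  obtain ⟨k2, k3⟩ := h'.max h2
  rw [k2] at hpos
  nlinarith

/-- Weak maximum principle on a box. -/
lemma box_le (D : ℝ → ℝ → ℝ) (A B c d : ℝ)
    (hcont : ContinuousOn (fun p : ℝ × ℝ => D p.1 p.2) (Icc A B ×ˢ Icc c d))
    (hInt : ∀ x ∈ Ioo A B, ∀ y ∈ Ioo c d,
      ¬ (IsLocalMax (fun x' => D x' y) x ∧ IsLocalMax (fun y' => D x y') y))
    (hA : ∀ y ∈ Icc c d, D A y ≤ 0) (hB : ∀ y ∈ Icc c d, D B y ≤ 0)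
    (htop : ∀ x ∈ Icc A B, D x d ≤ 0)
    (hbot : ∀ x ∈ Ioo A B, D x c ≤ 0 ∨ ¬ IsMaxOn (fun y => D x y) (Icc c d) c) :
    ∀ x ∈ Icc A B, ∀ y ∈ Icc c d, D x y ≤ 0 := by
  intro x hx y hy
  obtain ⟨⟨x0, y0⟩, ⟨hx0, hy0⟩, hmax⟩ :=
    (isCompact_Icc.prod isCompact_Icc).exists_isMaxOn ⟨(x, y), ⟨hx, hy⟩⟩ hcont
  have hmax' : ∀ x' ∈ Icc A B, ∀ y' ∈ Icc c d, D x' y' ≤ D x0 y0 :=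
    fun x' h1 y' h2 => hmax (show (x', y') ∈ Icc A B ×ˢ Icc c d from ⟨h1, h2⟩)
  simp only at hx0 hy0
  refine (hmax' x hx y hy).trans ?_
  rcases eq_or_lt_of_le hx0.1 with e | e1
  · rw [← e]; exact hA _ hy0
  rcases eq_or_lt_of_le hx0.2 with e | e2
  · rw [e]; exact hB _ hy0
  rcases eq_or_lt_of_le hy0.2 with e | e3
  · rw [e]; exact htop _ hx0
  rcases eq_or_lt_of_le hy0.1 with e | e4
  · rcases hbot x0 ⟨e1, e2⟩ with h | h
    · rw [← e]; exact h
    · exfalso; apply h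
      intro y' hy'
      have := hmax' x0 hx0 y' hy'
      rw [← e] at this; exact this
  · exfalso
    refine hInt x0 ⟨e1, e2⟩ y0 ⟨e4, e3⟩ ⟨?_, ?_⟩
    · filter_upwards [Icc_mem_nhds e1 e2] with x' hx' using hmax' x' hx' y0 hy0
    · filter_upwards [Icc_mem_nhds e4 e3] with y' hy' using hmax' x0 hx0 y' hy'

lemma bot_not_max {a d L : ℝ} {φ φ' : ℝ → ℝ} (hd : 0 < d) (hL : 0 < L)
    (hc : ContinuousOn φ (Icc 0 d)) (hder : ∀ y, 0 < y → y < d → HasDerivAt φ (φ' y) y)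
    (hlim : Tendsto (fun y => y ^ a * φ' y) (nhdsWithin 0 (Ioi 0)) (nhds L)) :
    ¬ IsMaxOn φ (Icc 0 d) 0 := by
  intro hm
  have h1 : ∀ᶠ y in nhdsWithin (0:ℝ) (Ioi 0), 0 < y ^ a * φ' y :=
    hlim.eventually (lt_mem_nhds hL)
  obtain ⟨e, he, hsub⟩ := mem_nhdsGT_iff_exists_Ioo_subset.1 h1
  have he : 0 < e := he
  set b := min (e/2) (d/2) with hb
  have hb0 : 0 < b := lt_min (by linarith) (by linarith)
  have hbe : b < e := (min_le_left _ _).trans_lt (by linarith)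
  have hbd : b < d := (min_le_right _ _).trans_lt (by linarith)
  have hmono : StrictMonoOn φ (Icc 0 b) := by
    apply strictMonoOn_of_deriv_pos (convex_Icc 0 b) (hc.mono (Icc_subset_Icc_right hbd.le))
    intro y hy
    rw [interior_Icc] at hy
    rw [(hder y hy.1 (hy.2.trans hbd)).deriv]
    have := hsub ⟨hy.1, hy.2.trans hbe⟩
    exact (mul_pos_iff_of_pos_left (rpow_pos_of_pos hy.1 a)).1 this
  have := hmono (left_mem_Icc.2 hb0.le) (right_mem_Icc.2 hb0.le) hb0
  have h2 := hm (show b ∈ Icc 0 d from ⟨hb0.le, hbd.le⟩)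
  have h2 : φ b ≤ φ 0 := h2
  linarith

/-- Classical solutions of the degenerate equation, continuous up to the boundary. -/
structure Har (a : ℝ) (W : ℝ → ℝ → ℝ) : Prop where
  cont : ContinuousOn (fun p : ℝ × ℝ => W p.1 p.2) {p : ℝ × ℝ | 0 ≤ p.2}
  pde : ∀ x y, 0 < y → ∃ p q p' q', SecD (fun x' => W x' y) x p q ∧
    SecD (fun r => W x r) y p' q' ∧ y * (q + q') + a * p' = 0

lemma Har.sub {a : ℝ} {W V : ℝ → ℝ → ℝ} (h : Har a W) (k : Har a V) :
    Har a (fun x y => W x y - V x y) := by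
  refine ⟨h.cont.sub k.cont, fun x y hy => ?_⟩
  obtain ⟨p, q, p', q', h1, h2, h3⟩ := h.pde x y hy
  obtain ⟨r, s, r', s', k1, k2, k3⟩ := k.pde x y hy
  exact ⟨_, _, _, _, h1.sub k1, h2.sub k2, by linarith⟩

lemma Har.const_mul {a : ℝ} {W : ℝ → ℝ → ℝ} (c : ℝ) (h : Har a W) :
    Har a (fun x y => c * W x y) := by
  refine ⟨continuousOn_const.mul h.cont, fun x y hy => ?_⟩
  obtain ⟨p, q, p', q', h1, h2, h3⟩ := h.pde x y hy
  exact ⟨_, _, _, _, h1.const_mul c, h2.const_mul c, by linear_combination c * h3⟩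

lemma Har.const (a c : ℝ) : Har a (fun _ _ => c) :=
  ⟨continuousOn_const, fun x y _ =>
    ⟨_, _, _, _, SecD.const c x, SecD.const c y, by ring⟩⟩

lemma Har.shift {a : ℝ} {W : ℝ → ℝ → ℝ} (c : ℝ) (h : Har a W) :
    Har a (fun x y => W (x + c) y) := by
  refine ⟨?_, fun x y hy => ?_⟩
  · refine h.cont.comp (f := fun p : ℝ × ℝ => (p.1 + c, p.2)) (by fun_prop) ?_
    intro p hp; exact hp
  · obtain ⟨p, q, p', q', h1, h2, h3⟩ := h.pde (x + c) y hy
    exact ⟨_, _, _, _, h1.comp_add c, h2, h3⟩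

lemma Har.refl {a : ℝ} {W : ℝ → ℝ → ℝ} (c : ℝ) (h : Har a W) :
    Har a (fun x y => W (c - x) y) := by
  refine ⟨?_, fun x y hy => ?_⟩
  · refine h.cont.comp (f := fun p : ℝ × ℝ => (c - p.1, p.2)) (by fun_prop) ?_
    intro p hp; exact hp
  · obtain ⟨p, q, p', q', h1, h2, h3⟩ := h.pde (c - x) y hy
    exact ⟨_, _, _, _, h1.comp_sub c, h2, h3⟩

/-- Odd difference. -/
lemma Har.odd {a : ℝ} {W : ℝ → ℝ → ℝ} (c : ℝ) (h : Har a W) :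
    Har a (fun k y => W (c + k) y - W (c - k) y) := by
  have := (h.shift c).sub (h.refl c)
  simpa [add_comm] using this

lemma secD_rpow (p : ℝ) {y : ℝ} (hy : 0 < y) :
    SecD (fun r => r ^ p) y (p * y ^ (p - 1)) (p * ((p - 1) * y ^ (p - 2))) := by
  refine ⟨fun r => p * r ^ (p - 1), ?_, rfl, ?_⟩
  · filter_upwards [lt_mem_nhds hy] with r hr
    exact hasDerivAt_rpow_const (Or.inl hr.ne')
  · have := (hasDerivAt_rpow_const (p := p - 1) (Or.inl hy.ne')).const_mul p
    rw [show p - 1 - 1 = p - 2 by ring] at this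
    exact this

lemma secD_sq (c t : ℝ) : SecD (fun r => (r - c) ^ 2) t (2 * (t - c)) 2 := by
  refine ⟨fun r => 2 * (r - c), ?_, rfl, ?_⟩
  · refine Eventually.of_forall fun r => ?_
    have := ((hasDerivAt_id' r).sub_const c).fun_pow 2
    exact this.congr_deriv (by push_cast; ring)
  · have := ((hasDerivAt_id' t).sub_const c).const_mul 2
    exact this.congr_deriv (by push_cast; ring)

lemma secD_bump (c t : ℝ) : SecD (fun r => (1 - (r - c) ^ 2) ^ 2) t
    (-4 * (t - c) * (1 - (t - c) ^ 2)) (12 * (t - c) ^ 2 - 4) := by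
  refine ⟨fun r => -4 * (r - c) * (1 - (r - c) ^ 2), ?_, rfl, ?_⟩
  · refine Eventually.of_forall fun r => ?_
    have := ((((hasDerivAt_id' r).sub_const c).fun_pow 2).const_sub 1).fun_pow 2
    exact this.congr_deriv (by push_cast; ring)
  · have h1 := ((hasDerivAt_id' t).sub_const c)
    have := (h1.const_mul (-4)).fun_mul ((h1.fun_pow 2).const_sub 1)
    exact this.congr_deriv (by push_cast; ring)

lemma secD_exp (l t : ℝ) : SecD (fun r => exp (-l * r)) t
    (-l * exp (-l * t)) (l ^ 2 * exp (-l * t)) := by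
  have h : ∀ r, HasDerivAt (fun r => exp (-l * r)) (-l * exp (-l * r)) r := by
    intro r
    have := ((hasDerivAt_id' r).const_mul (-l)).exp
    exact this.congr_deriv (by push_cast; ring)
  refine ⟨fun r => -l * exp (-l * r), Eventually.of_forall h, rfl, ?_⟩
  exact ((h t).const_mul (-l)).congr_deriv (by ring)

lemma box_decay {a : ℝ} (ha : -1 < a) (ha' : a < 1) {W : ℝ → ℝ → ℝ} (hW : Har a W)
    {M X Y x0 : ℝ} (hM : 0 < M) (hX : 0 < X) (hY : 0 < Y) (hXY : 2 * Y ^ 2 ≤ X ^ 2 * (1 + a))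
    (hb : ∀ x y, 0 ≤ y → W x y ≤ M) (h0 : ∀ x, |x - x0| ≤ X → W x 0 ≤ 0) :
    ∀ y ∈ Icc 0 Y, W x0 y ≤ 2 * M * (y / Y) ^ (1 - a) := by
  have ha1 : 0 < 1 + a := by linarith
  have ha2 : 0 < 1 - a := by linarith
  set K : ℝ := 2 / Y ^ (1 - a) with hK
  set N : ℝ := 2 / (X ^ 2 * (1 + a)) with hN
  have hN0 : 0 < N := by positivity
  have hNY : N * Y ^ 2 ≤ 1 := by
    rw [hN, div_mul_eq_mul_div, div_le_one (by positivity)]; exact hXY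
  have hKy : ∀ y, 0 ≤ y → K * y ^ (1 - a) = 2 * (y / Y) ^ (1 - a) := by
    intro y hy
    rw [div_rpow hy hY.le, hK]; ring
  have hpw : ∀ y ∈ Icc 0 Y, (y / Y) ^ 2 ≤ (y / Y) ^ (1 - a) := by
    intro y hy
    rcases eq_or_lt_of_le hy.1 with e | e
    · rw [← e]; simp [zero_rpow ha2.ne']
    · rw [← rpow_two]
      exact rpow_le_rpow_of_exponent_ge (by positivity) ((div_le_one hY).2 hy.2) (by linarith)
  have hNy : ∀ y ∈ Icc 0 Y, N * y ^ 2 ≤ (y / Y) ^ (1 - a) := by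
    intro y hy
    refine le_trans ?_ (hpw y hy)
    rw [div_pow, le_div_iff₀ (by positivity)]
    nlinarith [sq_nonneg y]
  have key := box_le (fun x y => W x y - M * ((1 / X ^ 2) * (x - x0) ^ 2
      + (K * y ^ (1 - a) - N * (y - 0) ^ 2))) (x0 - X) (x0 + X) 0 Y ?_ ?_ ?_ ?_ ?_ ?_
  · intro y hy
    have := key x0 ⟨by linarith, by linarith⟩ y hy
    simp only [sub_self, sub_zero] at this
    rw [hKy y hy.1] at this
    have h3 : 0 ≤ N * y ^ 2 := by positivity
    nlinarith
  · have h1 : ContinuousOn (fun p : ℝ × ℝ => W p.1 p.2) (Icc (x0 - X) (x0 + X) ×ˢ Icc 0 Y) :=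
      hW.cont.mono fun p hp => hp.2.1
    have h2 : Continuous (fun p : ℝ × ℝ => p.2 ^ (1 - a)) :=
      continuous_snd.rpow_const fun _ => Or.inr ha2.le
    refine h1.sub (Continuous.continuousOn ?_)
    fun_prop
  · intro x hx y hy
    obtain ⟨p, q, p', q', h1, h2, h3⟩ := hW.pde x y hy.1
    refine no_max (a := a) hy.1
      (h1.sub (((secD_sq x0 x).const_mul (1 / X ^ 2)).add (SecD.const _ x) |>.const_mul M))
      (h2.sub ((SecD.const _ y).add
        (((secD_rpow (1 - a) hy.1).const_mul K).sub ((secD_sq 0 y).const_mul N)) |>.const_mul M)) ?_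
    have e1 : y ^ (1 - a - 1) = y * y ^ (1 - a - 2) := by
      rw [show 1 - a - 1 = (1 - a - 2) + 1 by ring, rpow_add_one hy.1.ne', mul_comm]
    rw [e1]
    have e2 : N * (1 + a) = 2 / X ^ 2 := by rw [hN]; field_simp
    have : y * (q - M * (1 / X ^ 2 * 2 + 0) + (q' - M * (0 + (K * ((1 - a) *
        ((1 - a - 1) * y ^ (1 - a - 2))) - N * 2)))) + a * (p' - M * (0 + (K * ((1 - a) *
        (y * y ^ (1 - a - 2))) - N * (2 * (y - 0))))) = M * y * (2 / X ^ 2) := by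
      linear_combination h3 + 2 * M * y * e2
    rw [this]
    have := hy.1
    positivity
  · intro y hy
    have h5 := hKy y hy.1
    have h6 := hNy y hy
    have h7 := hb (x0 - X) y hy.1
    have h8 : (1 / X ^ 2) * (x0 - X - x0) ^ 2 = 1 := by
      have : x0 - X - x0 = -X := by ring
      rw [this]; field_simp
    have h9 : 0 ≤ (y / Y) ^ (1 - a) := rpow_nonneg (div_nonneg hy.1 hY.le) _
    rw [h8, h5, sub_zero]
    nlinarith
  · intro y hy
    have h5 := hKy y hy.1
    have h6 := hNy y hy
    have h7 := hb (x0 + X) y hy.1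
    have h8 : (1 / X ^ 2) * (x0 + X - x0) ^ 2 = 1 := by
      have : x0 + X - x0 = X := by ring
      rw [this]; field_simp
    have h9 : 0 ≤ (y / Y) ^ (1 - a) := rpow_nonneg (div_nonneg hy.1 hY.le) _
    rw [h8, h5, sub_zero]
    nlinarith
  · intro x hx
    have h7 := hb x Y hY.le
    have h5 := hKy Y hY.le
    rw [div_self hY.ne', one_rpow] at h5
    have h8 : 0 ≤ (1 / X ^ 2) * (x - x0) ^ 2 := by positivity
    rw [h5, sub_zero]
    nlinarith
  · intro x hx
    left
    have h7 := h0 x (abs_le.2 ⟨by linarith [hx.1], by linarith [hx.2]⟩)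
    have h8 : 0 ≤ (1 / X ^ 2) * (x - x0) ^ 2 := by positivity
    rw [zero_rpow ha2.ne']
    have : 0 ≤ M * (1 / X ^ 2 * (x - x0) ^ 2) := by positivity
    nlinarith

lemma interior_est {a : ℝ} (ha : -1 < a) (ha' : a < 1) {W : ℝ → ℝ → ℝ} (hW : Har a W)
    {x t m : ℝ} (ht : 0 < t) (hm : 0 < m)
    (h : ∀ k ∈ Icc 0 (t / 2), ∀ y ∈ Icc (t / 2) (3 * t / 2), W (x + k) y - W (x - k) y ≤ m) :
    ∀ k ∈ Icc 0 (t / 2), W (x + k) t - W (x - k) t ≤ 12 * m / t * k := by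
  have hD := hW.odd x
  set r : ℝ := t / 2 with hr
  have hr0 : 0 < r := by positivity
  have htr : t = 2 * r := by rw [hr]; ring
  set N := m / r ^ 2 with hN
  have hN0 : 0 < N := by positivity
  have hNr : N * r ^ 2 = m := by rw [hN]; field_simp
  have key := box_le (fun k y => (W (x + k) y - W (x - k) y)
      - N * ((3 * r ^ 2 - 3 * (k - r) ^ 2) + (y - t) ^ 2)) 0 r r (3 * t / 2) ?_ ?_ ?_ ?_ ?_ ?_
  · intro k hk
    have := key k hk t ⟨by linarith, by linarith⟩
    simp only [sub_self] at this
    have e : 12 * m / t * k = 6 * N * r * k := by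
      rw [htr, ← hNr]; field_simp; ring
    rw [e]
    nlinarith [mul_nonneg hN0.le (sq_nonneg k)]
  · have h1 : ContinuousOn (fun p : ℝ × ℝ => W (x + p.1) p.2 - W (x - p.1) p.2)
        (Icc 0 r ×ˢ Icc r (3 * t / 2)) :=
      hD.cont.mono fun p hp => hr0.le.trans hp.2.1
    refine h1.sub (Continuous.continuousOn ?_)
    fun_prop
  · intro k hk y hy
    have hy0 : 0 < y := hr0.trans hy.1
    obtain ⟨p, q, p', q', h1, h2, h3⟩ := hD.pde k y hy0
    refine no_max (a := a) hy0
      (h1.sub ((((SecD.const _ k).sub ((secD_sq r k).const_mul 3)).add (SecD.const _ k)).const_mul N))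
      (h2.sub (((SecD.const _ y).add (secD_sq t y)).const_mul N)) ?_
    have e : y * (q - N * (0 - 3 * 2 + 0) + (q' - N * (0 + 2))) + a * (p' - N * (0 + 2 * (y - t)))
      = N * (4 * y - 2 * a * (y - t)) := by linear_combination h3
    rw [e]
    apply mul_pos hN0
    have : |a * (y - t)| ≤ 1 * y := by
      rw [abs_mul]
      apply mul_le_mul (abs_le.2 ⟨by linarith, by linarith⟩) _ (abs_nonneg _) zero_le_one
      rw [abs_le]; constructor <;> linarith [hy.1, hy.2]
    have := (abs_le.1 this).2
    nlinarith
  · intro y hy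
    simp only [add_zero, sub_zero, sub_self, zero_sub]
    have : 0 ≤ N * (y - t) ^ 2 := by positivity
    nlinarith
  · intro y hy
    have := h r ⟨hr0.le, le_rfl⟩ y hy
    simp only [sub_self]
    have : 0 ≤ N * (y - t) ^ 2 := by positivity
    nlinarith
  · intro k hk
    have h4 := h k hk (3 * t / 2) ⟨by linarith, le_rfl⟩
    have h5 : 3 * t / 2 - t = r := by rw [hr]; ring
    rw [h5]
    have : 0 ≤ N * (3 * r ^ 2 - 3 * (k - r) ^ 2) :=
      mul_nonneg hN0.le (by nlinarith [hk.1, hk.2])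
    nlinarith
  · intro k hk
    left
    have h4 := h k ⟨hk.1.le, hk.2.le⟩ r ⟨le_rfl, by linarith⟩
    have h5 : r - t = - r := by rw [htr]; ring
    rw [h5]
    have : 0 ≤ N * (3 * r ^ 2 - 3 * (k - r) ^ 2) :=
      mul_nonneg hN0.le (by nlinarith [hk.1, hk.2])
    nlinarith

lemma deriv_nonneg_right {φ : ℝ → ℝ} {d r : ℝ} (hr : 0 < r) (h : HasDerivAt φ d 0)
    (h0 : φ 0 = 0) (hpos : ∀ k ∈ Icc 0 r, 0 ≤ φ k) : 0 ≤ d := by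
  have h1 := h.tendsto_slope_zero_right
  refine ge_of_tendsto h1 ?_
  filter_upwards [Ioo_mem_nhdsGT hr] with k hk
  rw [zero_add, h0, sub_zero, smul_eq_mul]
  exact mul_nonneg (inv_nonneg.2 hk.1.le) (hpos k ⟨hk.1.le, hk.2.le⟩)

lemma interior_deriv_aux {a : ℝ} (ha : -1 < a) (ha' : a < 1) {W : ℝ → ℝ → ℝ} (hW : Har a W)
    {x t m d : ℝ} (ht : 0 < t) (hm : 0 < m) (hd : HasDerivAt (fun x' => W x' t) d x)
    (h : ∀ k ∈ Icc 0 (t / 2), ∀ y ∈ Icc (t / 2) (3 * t / 2), W (x + k) y - W (x - k) y ≤ m) :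
    d ≤ 6 * m / t := by
  have key := interior_est ha ha' hW ht hm h
  have h1 : HasDerivAt (fun k => 12 * m / t * k - (W (x + k) t - W (x - k) t))
      (12 * m / t - (d - -d)) 0 := by
    have e1 : HasDerivAt (fun k => W (x + k) t) d 0 :=
      HasDerivAt.comp_const_add x 0 (by simpa using hd)
    have e2 : HasDerivAt (fun k => W (x - k) t) (-d) 0 :=
      HasDerivAt.comp_const_sub x 0 (by simpa using hd)
    have e3 := (hasDerivAt_id (0:ℝ)).const_mul (12 * m / t)
    rw [mul_one] at e3
    exact e3.sub (e1.sub e2)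
  have := deriv_nonneg_right (half_pos ht) h1 (by simp) fun k hk => by linarith [key k hk]
  have e : 6 * m / t = (12 * m / t) / 2 := by ring
  linarith

lemma interior_deriv {a : ℝ} (ha : -1 < a) (ha' : a < 1) {W : ℝ → ℝ → ℝ} (hW : Har a W)
    {x t m d : ℝ} (ht : 0 < t) (hm : 0 < m) (hd : HasDerivAt (fun x' => W x' t) d x)
    (h : ∀ k ∈ Icc 0 (t / 2), ∀ y ∈ Icc (t / 2) (3 * t / 2), |W (x + k) y - W (x - k) y| ≤ m) :
    |d| ≤ 6 * m / t := by
  rw [abs_le]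
  constructor
  · have := interior_deriv_aux ha ha' (hW.const_mul (-1)) (x := x) (d := -1 * d) ht hm
      (hd.const_mul (-1)) fun k hk y hy => by
        linarith [(abs_le.1 (h k hk y hy)).1]
    linarith
  · exact interior_deriv_aux ha ha' hW ht hm hd fun k hk y hy => (abs_le.1 (h k hk y hy)).2

lemma pos_box {a : ℝ} (ha : -1 < a) (ha' : a < 1) {D : ℝ → ℝ → ℝ} (hD : Har a D)
    {x0 y1 Y c : ℝ} (hy1 : 0 < y1) (hY : y1 < Y) (hc : 0 < c)
    (hnn : ∀ x y, 0 ≤ y → 0 ≤ D x y) (hb : ∀ x, |x - x0| ≤ 1 → c ≤ D x y1) :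
    ∀ y ∈ Icc y1 Y, c * (exp (-(1 / y1 + 10) * y) - exp (-(1 / y1 + 10) * Y)) ≤ D x0 y := by
  set l := 1 / y1 + 10 with hl
  have hl0 : 0 < l := by positivity
  have key := box_le (fun x y => c * ((1 - (x - x0) ^ 2) ^ 2 * (exp (-l * y) - exp (-l * Y)))
      - D x y) (x0 - 1) (x0 + 1) y1 Y ?_ ?_ ?_ ?_ ?_ ?_
  · intro y hy
    have := key x0 ⟨by linarith, by linarith⟩ y hy
    simp only [sub_self] at this
    norm_num at this
    simpa using this
  · have h1 : ContinuousOn (fun p : ℝ × ℝ => D p.1 p.2) (Icc (x0 - 1) (x0 + 1) ×ˢ Icc y1 Y) :=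
      hD.cont.mono fun p hp => hy1.le.trans hp.2.1
    refine ContinuousOn.sub (Continuous.continuousOn ?_) h1
    fun_prop
  · intro x hx y hy
    have hy0 : 0 < y := hy1.trans hy.1
    obtain ⟨p, q, p', q', h1, h2, h3⟩ := hD.pde x y hy0
    set φ := exp (-l * y) - exp (-l * Y) with hφ
    set z := (x - x0) ^ 2 with hz
    have s1 : SecD (fun x' => c * ((1 - (x' - x0) ^ 2) ^ 2 * φ) - D x' y) x
        (c * φ * (-4 * (x - x0) * (1 - (x - x0) ^ 2)) - p) (c * φ * (12 * z - 4) - q) := by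
      have := ((secD_bump x0 x).const_mul (c * φ)).sub h1
      convert this using 2
      ring
    have s2 : SecD (fun y' => c * ((1 - z) ^ 2 * (exp (-l * y') - exp (-l * Y))) - D x y') y
        (c * (1 - z) ^ 2 * (-l * exp (-l * y) - 0) - p')
        (c * (1 - z) ^ 2 * (l ^ 2 * exp (-l * y) - 0) - q') := by
      have := (((secD_exp l y).sub (SecD.const (exp (-l * Y)) y)).const_mul (c * (1 - z) ^ 2)).sub h2
      convert this using 2
      ring
    refine no_max (a := a) hy0 s1 s2 ?_
    have hφ0 : 0 < φ := by
      rw [hφ, sub_pos]; apply exp_lt_exp.2; nlinarith [hy.2]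
    set E := exp (-l * y) with hE
    have hE0 : 0 < E := exp_pos _
    have hφE : φ ≤ E := by rw [hφ]; linarith [exp_pos (-l * Y)]
    have e : y * (c * φ * (12 * z - 4) - q + (c * (1 - z) ^ 2 * (l ^ 2 * E - 0) - q')) +
        a * (c * (1 - z) ^ 2 * (-l * E - 0) - p') =
        c * (y * φ * (12 * z - 4) + (1 - z) ^ 2 * l * E * (l * y - a)) := by
      linear_combination -h3
    rw [e]
    apply mul_pos hc
    have hly : 10 * y ≤ l * y - a := by
      have : 1 ≤ 1 / y1 * y := by
        rw [one_div, inv_mul_eq_div, one_le_div hy1]; exact hy.1.le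
      rw [hl]; nlinarith
    have hl10 : 10 ≤ l := by
      have : 0 < 1 / y1 := by positivity
      linarith
    have hk : 100 * y * E ≤ l * E * (l * y - a) := by
      have : 10 * E * (10 * y) ≤ l * E * (l * y - a) := by gcongr
      linarith
    have hz0 : 0 ≤ z := sq_nonneg _
    have hk2 : (1 - z) ^ 2 * (100 * y * E) ≤ (1 - z) ^ 2 * (l * E * (l * y - a)) := by gcongr
    have hyE : 0 < y * E := by positivity
    have hyφ : 0 < y * φ := by positivity
    have hyφE : y * φ ≤ y * E := by gcongr
    rcases le_or_gt z (1 / 3) with hz1 | hz1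
    · have : (4 / 9 : ℝ) ≤ (1 - z) ^ 2 := by nlinarith
      nlinarith
    · have : 0 ≤ (1 - z) ^ 2 * (100 * y * E) := by positivity
      nlinarith
  · intro y hy
    have := hnn (x0 - 1) y (hy1.le.trans hy.1)
    simp only [sub_sub_cancel_left]; norm_num; exact this
  · intro y hy
    have := hnn (x0 + 1) y (hy1.le.trans hy.1)
    simp only [add_sub_cancel_left]; norm_num; exact this
  · intro x hx
    simp only [sub_self, mul_zero, zero_sub]
    linarith [hnn x Y (hy1.trans hY).le]
  · intro x hx
    left
    have h1 := hb x (abs_le.2 ⟨by linarith [hx.1], by linarith [hx.2]⟩)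
    have hz0 : 0 ≤ (x - x0) ^ 2 := sq_nonneg _
    have hz1 : (x - x0) ^ 2 ≤ 1 := by nlinarith [hx.1, hx.2]
    have h2 : exp (-l * y1) ≤ 1 := exp_le_one_iff.2 (by nlinarith)
    have h3 : exp (-l * Y) ≤ exp (-l * y1) := exp_le_exp.2 (by nlinarith)
    have h4 := exp_pos (-l * Y)
    have h5 : (1 - (x - x0) ^ 2) ^ 2 ≤ 1 := by nlinarith
    have h6 : (1 - (x - x0) ^ 2) ^ 2 * (exp (-l * y1) - exp (-l * Y)) ≤ 1 * 1 := by
      apply mul_le_mul h5 (by linarith) (by linarith) zero_le_one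
    nlinarith

/-- Working bundle: a bounded solution with names for its derivatives. -/
structure Sol (a M : ℝ) (g : ℝ → ℝ) (u ux uy uxx uxy uyy : ℝ → ℝ → ℝ) : Prop where
  ha : -1 < a
  ha' : a < 1
  hM : 0 < M
  bdd : ∀ x y, 0 ≤ y → |u x y| ≤ M
  cu : ContinuousOn (fun p : ℝ × ℝ => u p.1 p.2) {p : ℝ × ℝ | 0 ≤ p.2}
  cux : ContinuousOn (fun p : ℝ × ℝ => ux p.1 p.2) {p : ℝ × ℝ | 0 ≤ p.2}
  cuy : ContinuousOn (fun p : ℝ × ℝ => uy p.1 p.2) {p : ℝ × ℝ | 0 < p.2}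
  cuxx : ContinuousOn (fun p : ℝ × ℝ => uxx p.1 p.2) {p : ℝ × ℝ | 0 < p.2}
  cuxy : ContinuousOn (fun p : ℝ × ℝ => uxy p.1 p.2) {p : ℝ × ℝ | 0 < p.2}
  dx : ∀ x y, 0 ≤ y → HasDerivAt (fun x' => u x' y) (ux x y) x
  dy : ∀ x y, 0 < y → HasDerivAt (fun r => u x r) (uy x y) y
  dxx : ∀ x y, 0 < y → HasDerivAt (fun x' => ux x' y) (uxx x y) x
  dxy : ∀ x y, 0 < y → HasDerivAt (fun r => ux x r) (uxy x y) y
  dyx : ∀ x y, 0 < y → HasDerivAt (fun x' => uy x' y) (uxy x y) x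
  dyy : ∀ x y, 0 < y → HasDerivAt (fun r => uy x r) (uyy x y) y
  eqn : ∀ x y, 0 < y → y * (uxx x y + uyy x y) + a * uy x y = 0
  neu : ∀ x, Tendsto (fun y => y ^ a * uy x y) (nhdsWithin 0 (Ioi 0)) (nhds (-(g x)))
  glip : ∀ R : ℝ, ∃ K : ℝ, 0 ≤ K ∧ ∀ x ∈ Icc (-R) R, ∀ y ∈ Icc (-R) R, |g x - g y| ≤ K * |x - y|
  gbdd : ∃ K : ℝ, ∀ x, |g x| ≤ K

namespace Sol
variable {a M : ℝ} {g : ℝ → ℝ} {u ux uy uxx uxy uyy : ℝ → ℝ → ℝ}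

lemma har (S : Sol a M g u ux uy uxx uxy uyy) : Har a u := by
  refine ⟨S.cu, fun x y hy => ⟨ux x y, uxx x y, uy x y, uyy x y, ?_, ?_, S.eqn x y hy⟩⟩
  · exact ⟨fun x' => ux x' y, Eventually.of_forall fun x' => S.dx x' y hy.le, rfl, S.dxx x y hy⟩
  · refine ⟨fun r => uy x r, ?_, rfl, S.dyy x y hy⟩
    filter_upwards [lt_mem_nhds hy] with r hr using S.dy x r hr

lemma har_h (S : Sol a M g u ux uy uxx uxy uyy) (h : ℝ) :
    Har a (fun x y => h⁻¹ * (u (x + h) y - u x y)) :=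
  ((S.har.shift h).sub S.har).const_mul h⁻¹

lemma mvt (S : Sol a M g u ux uy uxx uxy uyy) {z h y c e : ℝ} (hh : 0 < h) (hy : 0 ≤ y)
    (hb : ∀ z' ∈ Icc z (z + h), |ux z' y - c| ≤ e) :
    |h⁻¹ * (u (z + h) y - u z y) - c| ≤ e := by
  obtain ⟨ξ, hξ, he⟩ := exists_hasDerivAt_eq_slope (fun x' => u x' y) (fun x' => ux x' y)
    (show z < z + h by linarith)
    (fun x' _ => (S.dx x' y hy).continuousAt.continuousWithinAt) (fun x' _ => S.dx x' y hy)
  have := hb ξ ⟨hξ.1.le, hξ.2.le⟩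
  rw [he] at this
  rw [add_sub_cancel_left, div_eq_inv_mul] at this
  exact this

lemma ux_far (S : Sol a M g u ux uy uxx uxy uyy) {x t : ℝ} (ht : 0 < t) :
    |ux x t| ≤ 12 * M / t := by
  have := interior_deriv S.ha S.ha' S.har (m := 2 * M) ht (by linarith [S.hM]) (S.dx x t ht.le) ?_
  · refine this.trans (le_of_eq ?_); ring
  · intro k hk y hy
    have hy0 : 0 ≤ y := by linarith [hy.1]
    have h1 := abs_le.1 (S.bdd (x + k) y hy0)
    have h2 := abs_le.1 (S.bdd (x - k) y hy0)
    rw [abs_le]; constructor <;> linarith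

lemma uxx_of_bound (S : Sol a M g u ux uy uxx uxy uyy) {x t m h0 : ℝ} (ht : 0 < t) (hm : 0 < m)
    (hh0 : 0 < h0)
    (hb : ∀ h, 0 < h → h < h0 → ∀ k ∈ Icc 0 (t / 2), ∀ y ∈ Icc (t / 2) (3 * t / 2),
      |h⁻¹ * (u (x + k + h) y - u (x + k) y) - h⁻¹ * (u (x - k + h) y - u (x - k) y)| ≤ m) :
    |uxx x t| ≤ 6 * m / t := by
  have h1 := (S.dxx x t ht).tendsto_slope_zero_right
  refine le_of_tendsto h1.abs ?_
  filter_upwards [Ioo_mem_nhdsGT hh0] with h hh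
  rw [smul_eq_mul]
  refine interior_deriv S.ha S.ha' (S.har_h h) (x := x) ht hm ?_ (hb h hh.1 hh.2)
  exact ((HasDerivAt.comp_add_const x h (S.dx (x + h) t ht.le)).sub (S.dx x t ht.le)).const_mul h⁻¹

lemma uxx_osc (S : Sol a M g u ux uy uxx uxy uyy) {x t c e : ℝ} (ht : 0 < t) (he : 0 < e)
    (hb : ∀ z y, |z - x| ≤ t → y ∈ Icc (t / 2) (3 * t / 2) → |ux z y - c| ≤ e) :
    |uxx x t| ≤ 12 * e / t := by
  have := S.uxx_of_bound (x := x) (m := 2 * e) ht (by linarith) (half_pos ht) ?_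
  · refine this.trans (le_of_eq ?_); ring
  · intro h hh hht k hk y hy
    have hy0 : 0 ≤ y := by linarith [hy.1]
    have h1 := S.mvt (z := x + k) (c := c) (e := e) hh hy0 fun z' hz' => hb z' y
      (abs_le.2 ⟨by linarith [hz'.1, hz'.2, hk.1, hk.2], by linarith [hz'.1, hz'.2, hk.1, hk.2]⟩) hy
    have h2 := S.mvt (z := x - k) (c := c) (e := e) hh hy0 fun z' hz' => hb z' y
      (abs_le.2 ⟨by linarith [hz'.1, hz'.2, hk.1, hk.2], by linarith [hz'.1, hz'.2, hk.1, hk.2]⟩) hy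
    rw [abs_le] at h1 h2 ⊢
    constructor <;> linarith

lemma uxx_far (S : Sol a M g u ux uy uxx uxy uyy) {x t : ℝ} (ht : 0 < t) :
    |uxx x t| ≤ 288 * M / t ^ 2 := by
  have hM := S.hM
  have := S.uxx_osc (x := x) (c := 0) (e := 24 * M / t) ht (by positivity) ?_
  · refine this.trans (le_of_eq ?_); field_simp; norm_num
  · intro z y hz hy
    have hy0 : 0 < y := by linarith [hy.1]
    rw [sub_zero]
    refine (S.ux_far hy0).trans ?_
    rw [div_le_div_iff₀ hy0 ht]
    nlinarith [hy.1]

lemma q_deriv (S : Sol a M g u ux uy uxx uxy uyy) {x t : ℝ} (ht : 0 < t) :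
    HasDerivAt (fun r => r ^ a * uy x r) (-(t ^ a * uxx x t)) t := by
  have := (hasDerivAt_rpow_const (p := a) (Or.inl ht.ne')).fun_mul (S.dyy x t ht)
  refine this.congr_deriv ?_
  have e : t ^ a = t ^ (a - 1) * t := by
    rw [← rpow_add_one ht.ne']; congr 1; ring
  rw [e]
  linear_combination t ^ (a - 1) * S.eqn x t ht

lemma uy_far (S : Sol a M g u ux uy uxx uxy uyy) {x y : ℝ} (hy : 0 < y) :
    |uy x y| ≤ 580 * M / y := by
  have hM := S.hM
  have hpow : ∀ t ∈ Icc y (2 * y), t ^ a ≤ 2 * y ^ a := by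
    intro t ht
    have ht0 : 0 < t := hy.trans_le ht.1
    rcases le_total 0 a with h | h
    · calc t ^ a ≤ (2 * y) ^ a := rpow_le_rpow ht0.le ht.2 h
        _ = 2 ^ a * y ^ a := mul_rpow zero_le_two hy.le
        _ ≤ 2 ^ (1:ℝ) * y ^ a := by
          gcongr
          · norm_num
          · exact S.ha'.le
        _ = 2 * y ^ a := by rw [rpow_one]
    · have := rpow_le_rpow_of_nonpos hy ht.1 h
      have h2 : 0 ≤ y ^ a := rpow_nonneg hy.le a
      linarith
  obtain ⟨ξ, hξ, he⟩ := exists_hasDerivAt_eq_slope (fun r => u x r) (fun r => uy x r)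
    (show y < 2 * y by linarith)
    (fun r hr => (S.dy x r (hy.trans_le hr.1)).continuousAt.continuousWithinAt)
    (fun r hr => S.dy x r (hy.trans hr.1))
  have hu1 : |uy x ξ| ≤ 2 * M / y := by
    rw [he, show 2 * y - y = y by ring, abs_div, abs_of_pos hy]
    have h1 := abs_le.1 (S.bdd x (2 * y) (by linarith))
    have h2 := abs_le.1 (S.bdd x y hy.le)
    gcongr
    rw [abs_le]; constructor <;> linarith
  have hya : 0 < y ^ a := rpow_pos_of_pos hy a
  have hbd : ∀ t ∈ Icc y (2 * y), ‖-(t ^ a * uxx x t)‖ ≤ 2 * y ^ a * (288 * M / y ^ 2) := by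
    intro t ht
    have ht0 : 0 < t := hy.trans_le ht.1
    rw [norm_neg, norm_mul, Real.norm_eq_abs, Real.norm_eq_abs, abs_of_pos (rpow_pos_of_pos ht0 a)]
    refine mul_le_mul (hpow t ht) ((S.uxx_far ht0).trans ?_) (abs_nonneg _) (by positivity)
    have := ht.1
    gcongr
  have hd := (convex_Icc y (2 * y)).norm_image_sub_le_of_norm_hasDerivWithin_le
    (f := fun r => r ^ a * uy x r)
    (fun t ht => (S.q_deriv (x := x) (hy.trans_le ht.1)).hasDerivWithinAt) hbd
    (show ξ ∈ Icc y (2 * y) from ⟨hξ.1.le, hξ.2.le⟩) (show y ∈ Icc y (2 * y) from ⟨le_rfl, by linarith⟩)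
  rw [Real.norm_eq_abs, Real.norm_eq_abs] at hd
  have h3 : |y - ξ| ≤ y := by rw [abs_le]; constructor <;> linarith [hξ.1, hξ.2]
  have h4 : |ξ ^ a * uy x ξ| ≤ 2 * y ^ a * (2 * M / y) := by
    rw [abs_mul, abs_of_pos (rpow_pos_of_pos (hy.trans hξ.1) a)]
    exact mul_le_mul (hpow ξ ⟨hξ.1.le, hξ.2.le⟩) hu1 (abs_nonneg _) (by positivity)
  have h5 : |y ^ a * uy x y| ≤ y ^ a * (580 * M / y) := by
    have h6 : 2 * y ^ a * (288 * M / y ^ 2) * |y - ξ| ≤ 2 * y ^ a * (288 * M / y ^ 2) * y := by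
      gcongr
    have h7 : 2 * y ^ a * (288 * M / y ^ 2) * y + 2 * y ^ a * (2 * M / y)
        = y ^ a * (580 * M / y) := by field_simp; norm_num
    have h8 := abs_sub_abs_le_abs_sub (y ^ a * uy x y) (ξ ^ a * uy x ξ)
    linarith
  rw [abs_mul, abs_of_pos hya] at h5
  exact le_of_mul_le_mul_left h5 hya

lemma nonneg_diff (S : Sol a M g u ux uy uxx uxy uyy) (hpos : ∀ x, 0 < ux x 0) {h : ℝ}
    (hh : 0 ≤ h) : ∀ x y, 0 ≤ y → 0 ≤ u (x + h) y - u x y := by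
  intro x y hy
  have hM := S.hM
  have ha1 : 0 < 1 + a := by linarith [S.ha]
  have ha2 : 0 < 1 - a := by linarith [S.ha']
  have hmono : StrictMono (fun x => u x 0) := by
    apply strictMono_of_deriv_pos
    intro x; rw [(S.dx x 0 le_rfl).deriv]; exact hpos x
  have hW := S.har.sub (S.har.shift h)
  have key : ∀ᶠ Y : ℝ in atTop, u x y - u (x + h) y ≤ 2 * (2 * M) * (y / Y) ^ (1 - a) := by
    filter_upwards [eventually_ge_atTop y, eventually_gt_atTop 0] with Y hY hY0
    refine box_decay S.ha S.ha' hW (X := 2 * Y / (1 + a)) (by linarith) (by positivity) hY0 ?_ ?_ ?_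
      y ⟨hy, hY⟩
    · rw [div_pow, div_mul_eq_mul_div, le_div_iff₀ (by positivity)]
      have : 0 ≤ Y ^ 2 * (1 + a) * (1 - a) := by positivity
      nlinarith
    · intro x y hy
      have h1 := abs_le.1 (S.bdd x y hy)
      have h2 := abs_le.1 (S.bdd (x + h) y hy)
      linarith
    · intro z _
      have := hmono.monotone (show z ≤ z + h by linarith)
      linarith
  have hl : Tendsto (fun Y : ℝ => 2 * (2 * M) * (y / Y) ^ (1 - a)) atTop (nhds 0) := by
    have h1 : Tendsto (fun Y : ℝ => y / Y) atTop (nhds 0) := tendsto_const_nhds.div_atTop tendsto_id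
    have h2 := (h1.rpow_const (p := 1 - a) (Or.inr ha2.le)).const_mul (2 * (2 * M))
    rw [zero_rpow ha2.ne', mul_zero] at h2
    exact h2
  have := ge_of_tendsto hl key
  linarith

lemma ux_pos (S : Sol a M g u ux uy uxx uxy uyy) (hpos : ∀ x, 0 < ux x 0) {x y : ℝ}
    (hy : 0 ≤ y) : 0 < ux x y := by
  rcases eq_or_lt_of_le hy with e | hy
  · rw [← e]; exact hpos x
  obtain ⟨y1, hy1, hyy, c, hc, hcb⟩ : ∃ y1, 0 < y1 ∧ y1 < y ∧ ∃ c, 0 < c ∧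
      ∀ z ∈ Icc (x - 2) (x + 2), c ≤ ux z y1 := by
    have hopen : ∀ᶠ y1 in nhdsWithin (0:ℝ) (Ioi 0), ∀ z ∈ Icc (x - 2) (x + 2), 0 < ux z y1 := by
      by_contra hcon
      have hK : IsCompact (Icc (x - 2) (x + 2) ×ˢ Icc (0:ℝ) 1) := isCompact_Icc.prod isCompact_Icc
      have huc := hK.uniformContinuousOn_of_continuous
        (S.cux.mono (fun p hp => hp.2.1))
      have hcont0 : ContinuousOn (fun z => ux z 0) (Icc (x - 2) (x + 2)) :=
        S.cux.comp (f := fun z : ℝ => (z, (0:ℝ))) (by fun_prop)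
          (fun z _ => show (0:ℝ) ≤ 0 from le_rfl)
      obtain ⟨z0, hz0, hmin⟩ := isCompact_Icc.exists_isMinOn
        (nonempty_Icc.2 (by linarith : x - 2 ≤ x + 2)) hcont0
      rw [Metric.uniformContinuousOn_iff] at huc
      obtain ⟨δ, hδ, hd⟩ := huc (ux z0 0) (hpos z0)
      apply hcon
      filter_upwards [Ioo_mem_nhdsGT (lt_min hδ one_pos)] with y1 h1 z hz
      have h2 := hd (z, y1) ⟨hz, h1.1.le, h1.2.le.trans (min_le_right _ _)⟩ (z, 0)
        ⟨hz, le_rfl, zero_le_one⟩ (by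
          rw [Prod.dist_eq, dist_self, Real.dist_eq, sub_zero, abs_of_pos h1.1]
          exact max_lt hδ (h1.2.trans_le (min_le_left _ _)))
      rw [Real.dist_eq] at h2
      have h3 : ux z0 0 ≤ ux z 0 := hmin hz
      have := (abs_lt.1 h2).1
      simp only at this
      linarith
    obtain ⟨y1, h1, h2⟩ := (hopen.and (Ioo_mem_nhdsGT hy)).exists
    have hcont1 : ContinuousOn (fun z => ux z y1) (Icc (x - 2) (x + 2)) :=
      S.cux.comp (f := fun z : ℝ => (z, y1)) (by fun_prop) (fun z _ => h2.1.le)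
    obtain ⟨z0, hz0, hmin⟩ := isCompact_Icc.exists_isMinOn
      (nonempty_Icc.2 (by linarith : x - 2 ≤ x + 2)) hcont1
    exact ⟨y1, h2.1, h2.2, ux z0 y1, h1 z0 hz0, fun z hz => hmin hz⟩
  set b := exp (-(1 / y1 + 10) * y) - exp (-(1 / y1 + 10) * (y + 1)) with hb
  have hb0 : 0 < b := by
    rw [hb, sub_pos]; apply exp_lt_exp.2
    have : 0 < 1 / y1 := by positivity
    nlinarith
  have hlow : c * b ≤ ux x y := by
    have h1 := (S.dx x y hy.le).tendsto_slope_zero_right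
    refine ge_of_tendsto h1 ?_
    filter_upwards [Ioo_mem_nhdsGT one_pos] with h hh
    have hh0 : 0 < h := hh.1
    rw [smul_eq_mul, inv_mul_eq_div, le_div_iff₀ hh0]
    have := pos_box S.ha S.ha' ((S.har.shift h).sub S.har) (x0 := x) (Y := y + 1)
      (c := c * h) hy1 (by linarith) (by positivity) (S.nonneg_diff hpos hh0.le) ?_ y
      ⟨hyy.le, by linarith⟩
    · rw [← hb] at this; linarith
    · intro z hz
      rw [abs_le] at hz
      obtain ⟨ξ, hξ, he⟩ := exists_hasDerivAt_eq_slope (fun x' => u x' y1) (fun x' => ux x' y1)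
        (show z < z + h by linarith)
        (fun x' _ => (S.dx x' y1 hy1.le).continuousAt.continuousWithinAt)
        (fun x' _ => S.dx x' y1 hy1.le)
      have h2 := hcb ξ ⟨by linarith [hξ.1, hξ.2, hz.1, hz.2, hh.2],
        by linarith [hξ.1, hξ.2, hz.1, hz.2, hh.2]⟩
      rw [he, add_sub_cancel_left, le_div_iff₀ hh0] at h2
      exact h2
  exact lt_of_lt_of_le (mul_pos hc hb0) hlow

lemma lim_u (S : Sol a M g u ux uy uxx uxy uyy) {l : Filter ℝ} {L : ℝ}
    (hl : ∀ X : ℝ, 0 < X → ∀ e, 0 < e → ∀ᶠ x in l, ∀ z, |z - x| ≤ X → |u z 0 - L| ≤ e)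
    {y : ℝ} (hy : 0 ≤ y) : Tendsto (fun x => u x y) l (nhds L) := by
  have hM := S.hM
  have ha1 : 0 < 1 + a := by linarith [S.ha]
  have ha2 : 0 < 1 - a := by linarith [S.ha']
  set N := M + |L| with hN
  have hN0 : 0 < N := by positivity
  rw [Metric.tendsto_nhds]
  intro e he
  have hlim : Tendsto (fun Y : ℝ => 2 * N * (y / Y) ^ (1 - a)) atTop (nhds 0) := by
    have h1 : Tendsto (fun Y : ℝ => y / Y) atTop (nhds 0) := tendsto_const_nhds.div_atTop tendsto_id
    have h2 := (h1.rpow_const (p := 1 - a) (Or.inr ha2.le)).const_mul (2 * N)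
    rw [zero_rpow ha2.ne', mul_zero] at h2
    exact h2
  obtain ⟨Y, hY1, hY2, hY3⟩ := ((hlim.eventually (gt_mem_nhds (half_pos he))).and
    ((eventually_ge_atTop y).and (eventually_gt_atTop 0))).exists
  have hX : 2 * Y ^ 2 ≤ (2 * Y / (1 + a)) ^ 2 * (1 + a) := by
    rw [div_pow, div_mul_eq_mul_div, le_div_iff₀ (by positivity)]
    have : 0 ≤ Y ^ 2 * (1 + a) * (1 - a) := by positivity
    nlinarith
  have hX0 : 0 < 2 * Y / (1 + a) := by positivity
  have hbb : ∀ x y, 0 ≤ y → |u x y - L| ≤ N := fun x y hy =>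
    (abs_sub _ _).trans (by linarith [S.bdd x y hy])
  filter_upwards [hl (2 * Y / (1 + a)) hX0 (e / 2) (half_pos he)] with x hx
  have h1 := box_decay S.ha S.ha' (S.har.sub (Har.const a (L + e / 2))) (x0 := x) hN0 hX0 hY3 hX
    (fun x y hy => by linarith [(abs_le.1 (hbb x y hy)).2])
    (fun z hz => by linarith [(abs_le.1 (hx z hz)).2]) y ⟨hy, hY2⟩
  have h2 := box_decay S.ha S.ha' ((Har.const a (L - e / 2)).sub S.har) (x0 := x) hN0 hX0 hY3 hX
    (fun x y hy => by linarith [(abs_le.1 (hbb x y hy)).1])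
    (fun z hz => by linarith [(abs_le.1 (hx z hz)).1]) y ⟨hy, hY2⟩
  rw [Real.dist_eq, abs_lt]
  constructor <;> linarith

end Sol

lemma secD_radial (b c t : ℝ) (hc : 0 < t ^ 2 + c) :
    SecD (fun r => (r ^ 2 + c) ^ b) t (2 * b * t * (t ^ 2 + c) ^ (b - 1))
      (2 * b * (t ^ 2 + c) ^ (b - 1) + 4 * b * (b - 1) * t ^ 2 * (t ^ 2 + c) ^ (b - 2)) := by
  have hq : ∀ r : ℝ, HasDerivAt (fun r : ℝ => r ^ 2 + c) (2 * r) r := by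
    intro r
    have := ((hasDerivAt_id' r).fun_pow 2).add_const c
    exact this.congr_deriv (by push_cast; ring)
  have hp : ∀ b : ℝ, ∀ r : ℝ, 0 < r ^ 2 + c →
      HasDerivAt (fun r => (r ^ 2 + c) ^ b) (2 * b * r * (r ^ 2 + c) ^ (b - 1)) r := by
    intro b r hr
    have := (hq r).rpow_const (p := b) (Or.inl hr.ne')
    exact this.congr_deriv (by ring)
  refine ⟨fun r => 2 * b * r * (r ^ 2 + c) ^ (b - 1), ?_, rfl, ?_⟩
  · have : ContinuousAt (fun r : ℝ => r ^ 2 + c) t := by fun_prop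
    filter_upwards [this.eventually (lt_mem_nhds hc)] with r hr using hp b r hr
  · have := ((hasDerivAt_id' t).const_mul (2 * b)).fun_mul (hp (b - 1) t hc)
    refine this.congr_deriv ?_
    rw [show b - 1 - 1 = b - 2 by ring]
    ring

lemma holder_barrier {a b : ℝ} (ha : -1 < a) (ha' : a ≤ 0) (hb : b = (1 - a) / 2)
    {W Wy : ℝ → ℝ → ℝ} (hW : Har a W)
    (hdy : ∀ z y, 0 < y → HasDerivAt (fun r => W z r) (Wy z y) y)
    {x R m K A N : ℝ} (hR : 0 < R)
    (hm : ∀ z y, |z - x| ≤ R → y ∈ Icc 0 R → |W z y| ≤ m)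
    (hneu : ∀ z, |z - x| ≤ R → ∃ L, |L| ≤ K ∧
      Tendsto (fun y => y ^ a * Wy z y) (nhdsWithin 0 (Ioi 0)) (nhds L))
    (hN0 : 0 ≤ N) (hN : 2 * K < N * (1 - a)) (hA0 : 0 ≤ A) (hA : 2 * m ≤ A * R ^ b)
    (hA2 : N * (2 * b) * R ^ b + 4 * m * (1 + a) / R ^ 2 * R ^ (2 - b) < A * (b * (1 - b))) :
    ∀ k ∈ Icc 0 R, ∀ y ∈ Icc 0 R, W (x + k) y - W (x - k) y ≤
      A * k ^ b + N * ((k ^ 2 + y ^ 2) ^ b - y ^ (1 - a)) + 2 * m / R ^ 2 * y ^ 2 := by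
  have hD := hW.odd x
  have hb0 : 0 < b := by rw [hb]; linarith
  have hb1 : b < 1 := by rw [hb]; linarith
  have ha2 : 0 < 1 - a := by linarith
  have hba : 2 * b + a = 1 := by rw [hb]; ring
  have hm0 : 0 ≤ m := (abs_nonneg _).trans (hm x 0 (by simp [hR.le]) ⟨le_rfl, hR.le⟩)
  have hrad : ∀ k y : ℝ, 0 ≤ y → 0 ≤ (k ^ 2 + y ^ 2) ^ b - y ^ (1 - a) := by
    intro k y hy
    have : y ^ (1 - a) = (y ^ 2) ^ b := by
      rw [← rpow_natCast_mul hy, hb]; congr 1; push_cast; ring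
    rw [this, sub_nonneg]
    exact rpow_le_rpow (sq_nonneg y) (by nlinarith [sq_nonneg k]) hb0.le
  have hDm : ∀ k ∈ Icc 0 R, ∀ y ∈ Icc 0 R, W (x + k) y - W (x - k) y ≤ 2 * m := by
    intro k hk y hy
    have h1 := abs_le.1 (hm (x + k) y (by rw [add_sub_cancel_left, abs_of_nonneg hk.1]; exact hk.2) hy)
    have h2 := abs_le.1 (hm (x - k) y
      (by rw [sub_sub_cancel_left, abs_neg, abs_of_nonneg hk.1]; exact hk.2) hy)
    linarith
  have key := box_le (fun k y => (W (x + k) y - W (x - k) y) -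
      (A * k ^ b + N * ((k ^ 2 + y ^ 2) ^ b - y ^ (1 - a)) + 2 * m / R ^ 2 * (y - 0) ^ 2))
      0 R 0 R ?_ ?_ ?_ ?_ ?_ ?_
  · intro k hk y hy
    have := key k hk y hy
    rw [sub_zero] at this
    linarith
  · have h1 : ContinuousOn (fun p : ℝ × ℝ => W (x + p.1) p.2 - W (x - p.1) p.2)
        (Icc 0 R ×ˢ Icc 0 R) := hD.cont.mono fun p hp => hp.2.1
    have h2 : Continuous (fun p : ℝ × ℝ => p.2 ^ (1 - a)) :=
      continuous_snd.rpow_const fun _ => Or.inr ha2.le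
    have h3 : Continuous (fun p : ℝ × ℝ => p.1 ^ b) :=
      continuous_fst.rpow_const fun _ => Or.inr hb0.le
    have h4 : Continuous (fun p : ℝ × ℝ => (p.1 ^ 2 + p.2 ^ 2) ^ b) :=
      Continuous.rpow_const (by fun_prop) fun _ => Or.inr hb0.le
    refine h1.sub (Continuous.continuousOn ?_)
    fun_prop
  · intro k hk y hy
    have hk0 : 0 < k := hk.1
    have hy0 : 0 < y := hy.1
    obtain ⟨p, q, p', q', h1, h2, h3⟩ := hD.pde k y hy0
    have hS : 0 < k ^ 2 + y ^ 2 := by positivity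
    have r1 := secD_radial b (y ^ 2) k hS
    have r2 : SecD (fun r => (k ^ 2 + r ^ 2) ^ b) y (2 * b * y * (k ^ 2 + y ^ 2) ^ (b - 1))
      (2 * b * (k ^ 2 + y ^ 2) ^ (b - 1) + 4 * b * (b - 1) * y ^ 2 * (k ^ 2 + y ^ 2) ^ (b - 2)) := by
      have := secD_radial b (k ^ 2) y (by positivity)
      simpa only [add_comm] using this
    refine no_max (a := a) hy0
      (h1.sub ((((secD_rpow b hk0).const_mul A).add
        ((r1.sub (SecD.const _ k)).const_mul N)).add (SecD.const _ k)))
      (h2.sub (((SecD.const _ y).add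
        ((r2.sub (secD_rpow (1 - a) hy0)).const_mul N)).add
          ((secD_sq 0 y).const_mul (2 * m / R ^ 2)))) ?_
    have e1 : y ^ (1 - a - 1) = y * y ^ (1 - a - 2) := by
      rw [show 1 - a - 1 = (1 - a - 2) + 1 by ring, rpow_add_one hy0.ne', mul_comm]
    have e2 : (k ^ 2 + y ^ 2) ^ (b - 1) = (k ^ 2 + y ^ 2) * (k ^ 2 + y ^ 2) ^ (b - 2) := by
      rw [show b - 1 = (b - 2) + 1 by ring, rpow_add_one hS.ne', mul_comm]
    set T := (k ^ 2 + y ^ 2) ^ (b - 2) with hT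
    set Y := y ^ (1 - a - 2) with hYd
    have hTk : (k ^ 2 + y ^ 2) * T ≤ k ^ (b - 2) * R ^ b := by
      rw [← e2]
      calc (k ^ 2 + y ^ 2) ^ (b - 1) ≤ (k ^ 2) ^ (b - 1) :=
            rpow_le_rpow_of_nonpos (by positivity) (by nlinarith) (by linarith)
        _ = k ^ (b - 2) * k ^ b := by
            rw [← rpow_natCast_mul hk0.le, ← rpow_add hk0]; congr 1; push_cast; ring
        _ ≤ k ^ (b - 2) * R ^ b := by
            gcongr
            exact hk.2.le
    have h1k : 1 ≤ k ^ (b - 2) * R ^ (2 - b) := by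
      calc (1:ℝ) = k ^ (b - 2) * k ^ (2 - b) := by
            rw [← rpow_add hk0]; simp
        _ ≤ k ^ (b - 2) * R ^ (2 - b) := by
            gcongr
            · linarith
            · exact hk.2.le
    have hkp : 0 < k ^ (b - 2) := rpow_pos_of_pos hk0 _
    rw [e1, e2]
    have e : y * (q - (A * (b * ((b - 1) * k ^ (b - 2))) + N * (2 * b * ((k ^ 2 + y ^ 2) * T) +
          4 * b * (b - 1) * k ^ 2 * T - 0) + 0) + (q' - (0 + N * (2 * b * ((k ^ 2 + y ^ 2) * T) +
          4 * b * (b - 1) * y ^ 2 * T - (1 - a) * ((1 - a - 1) * Y)) + 2 * m / R ^ 2 * 2))) +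
        a * (p' - (0 + N * (2 * b * y * ((k ^ 2 + y ^ 2) * T) - (1 - a) * (y * Y)) +
          2 * m / R ^ 2 * (2 * (y - 0)))) =
        y * (A * (b * (1 - b)) * k ^ (b - 2) - N * (2 * b) * ((k ^ 2 + y ^ 2) * T)
          - 4 * m * (1 + a) / R ^ 2) := by
      linear_combination h3 - N * (2 * b) * y * ((k ^ 2 + y ^ 2) * T) * hba
    rw [e]
    apply mul_pos hy0
    have f1 : N * (2 * b) * ((k ^ 2 + y ^ 2) * T) ≤ N * (2 * b) * (k ^ (b - 2) * R ^ b) := by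
      gcongr
    have f2 : 4 * m * (1 + a) / R ^ 2 * 1 ≤ 4 * m * (1 + a) / R ^ 2 * (k ^ (b - 2) * R ^ (2 - b)) := by
      apply mul_le_mul_of_nonneg_left h1k
      have : 0 < 1 + a := by linarith
      positivity
    nlinarith [mul_lt_mul_of_pos_right hA2 hkp]
  · intro y hy
    have h1 := hrad 0 y hy.1
    have h2 : 0 ≤ 2 * m / R ^ 2 * y ^ 2 := by positivity
    simp only [add_zero, sub_zero, sub_self, zero_sub]
    rw [zero_rpow hb0.ne']
    have h3 := mul_nonneg hN0 h1
    generalize N * (((0:ℝ) ^ 2 + y ^ 2) ^ b - y ^ (1 - a)) = T at h3 ⊢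
    linarith
  · intro y hy
    have h1 := hrad R y hy.1
    have h2 : 0 ≤ 2 * m / R ^ 2 * y ^ 2 := by positivity
    have h3 := hDm R ⟨hR.le, le_rfl⟩ y hy
    rw [sub_zero]
    nlinarith [mul_nonneg hN0 h1]
  · intro k hk
    have h1 := hrad k R hR.le
    have h2 : 2 * m / R ^ 2 * R ^ 2 = 2 * m := by field_simp
    have h3 := hDm k hk R ⟨hR.le, le_rfl⟩
    have h4 : 0 ≤ A * k ^ b := mul_nonneg hA0 (rpow_nonneg hk.1 _)
    rw [sub_zero]
    nlinarith [mul_nonneg hN0 h1]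
  · intro k hk
    right
    have hk0 : 0 < k := hk.1
    obtain ⟨L1, hL1, t1⟩ := hneu (x + k) (by rw [add_sub_cancel_left, abs_of_pos hk0]; exact hk.2.le)
    obtain ⟨L2, hL2, t2⟩ := hneu (x - k)
      (by rw [sub_sub_cancel_left, abs_neg, abs_of_pos hk0]; exact hk.2.le)
    have hLpos : 0 < (L1 - L2) - (N * (0 - (1 - a)) + 0) := by
      have := abs_le.1 hL1
      have := abs_le.1 hL2
      linarith
    refine bot_not_max (a := a) (φ' := fun y => (Wy (x + k) y - Wy (x - k) y) -
        (0 + N * (2 * b * y * (k ^ 2 + y ^ 2) ^ (b - 1) - (1 - a) * y ^ (1 - a - 1))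
          + 2 * m / R ^ 2 * (2 * (y - 0)))) hR hLpos ?_ ?_ ?_
    · have h1 : ContinuousOn (fun y : ℝ => W (x + k) y - W (x - k) y) (Icc 0 R) :=
        hD.cont.comp (f := fun y : ℝ => (k, y)) (by fun_prop) (fun y hy => hy.1)
      have h2 : Continuous (fun y : ℝ => y ^ (1 - a)) :=
        continuous_id.rpow_const fun _ => Or.inr ha2.le
      have h4 : Continuous (fun y : ℝ => (k ^ 2 + y ^ 2) ^ b) :=
        Continuous.rpow_const (by fun_prop) fun _ => Or.inr hb0.le
      refine h1.sub (Continuous.continuousOn ?_)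
      fun_prop
    · intro y hy0 _
      have r2 : SecD (fun r => (k ^ 2 + r ^ 2) ^ b) y (2 * b * y * (k ^ 2 + y ^ 2) ^ (b - 1))
        (2 * b * (k ^ 2 + y ^ 2) ^ (b - 1) + 4 * b * (b - 1) * y ^ 2 * (k ^ 2 + y ^ 2) ^ (b - 2)) := by
        have := secD_radial b (k ^ 2) y (by positivity)
        simpa only [add_comm] using this
      exact ((hdy (x + k) y hy0).sub (hdy (x - k) y hy0)).sub
        ((((SecD.const _ y).add ((r2.sub (secD_rpow (1 - a) hy0)).const_mul N)).add
          ((secD_sq 0 y).const_mul (2 * m / R ^ 2))).hasDerivAt)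
    · have z1 : Tendsto (fun y : ℝ => y ^ (1 + a)) (nhdsWithin 0 (Ioi 0)) (nhds 0) := by
        have : Continuous (fun y : ℝ => y ^ (1 + a)) :=
          continuous_id.rpow_const fun _ => Or.inr (by linarith)
        have h := this.tendsto 0
        rw [zero_rpow (by linarith)] at h
        exact h.mono_left nhdsWithin_le_nhds
      have z2 : Tendsto (fun y : ℝ => (k ^ 2 + y ^ 2) ^ (b - 1)) (nhdsWithin 0 (Ioi 0))
          (nhds ((k ^ 2 + 0 ^ 2) ^ (b - 1))) := by
        have : ContinuousAt (fun y : ℝ => (k ^ 2 + y ^ 2) ^ (b - 1)) 0 :=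
          ContinuousAt.rpow_const (by fun_prop) (Or.inl (by positivity))
        exact this.tendsto.mono_left nhdsWithin_le_nhds
      have z3 := (t1.sub t2).sub ((((z1.mul z2).const_mul (2 * b)).sub_const (1 - a) |>.const_mul N).add
        (z1.const_mul (4 * m / R ^ 2)))
      simp only [zero_mul, mul_zero] at z3
      refine z3.congr' ?_
      filter_upwards [self_mem_nhdsWithin] with y hy
      have hy0 : 0 < y := hy
      have e1 : y ^ (1 + a) = y ^ a * y := by rw [add_comm, rpow_add_one hy0.ne']
      have e2 : y ^ a * y ^ (1 - a - 1) = 1 := by rw [← rpow_add hy0]; simp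
      rw [e1]
      linear_combination (-(N * (1 - a))) * e2

namespace Sol
variable {a M : ℝ} {g : ℝ → ℝ} {u ux uy uxx uxy uyy : ℝ → ℝ → ℝ}

lemma ux_loc (S : Sol a M g u ux uy uxx uxy uyy) (R : ℝ) :
    ∃ K, 0 < K ∧ ∀ z ∈ Icc (-R) R, ∀ y ∈ Icc 0 R, |ux z y| ≤ K := by
  have hK : IsCompact (Icc (-R) R ×ˢ Icc (0:ℝ) R) := isCompact_Icc.prod isCompact_Icc
  obtain ⟨K, hK⟩ := hK.exists_bound_of_continuousOn (S.cux.mono (fun p hp => hp.2.1))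
  refine ⟨max K 1, by positivity, fun z hz y hy => ?_⟩
  exact (hK (z, y) ⟨hz, hy⟩).trans (le_max_left _ _)

lemma uxx_near (S : Sol a M g u ux uy uxx uxy uyy) :
    ∃ κ : ℝ, 0 < κ ∧ ∀ R : ℝ, 0 < R → ∃ C : ℝ, 0 ≤ C ∧
      ∀ x ∈ Icc (-R) R, ∀ t, 0 < t → t ≤ R → |uxx x t| ≤ C * t ^ (κ - 1 - a) := by
  rcases lt_or_ge 0 a with ha | ha
  · refine ⟨a, ha, fun R hR => ?_⟩
    obtain ⟨K, hK0, hK⟩ := S.ux_loc (2 * R)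
    refine ⟨12 * K, by positivity, fun x hx t ht htR => ?_⟩
    rw [show a - 1 - a = -1 by ring, rpow_neg_one]
    refine S.uxx_osc (c := 0) ht hK0 fun z y hz hy => ?_
    rw [sub_zero]
    rw [abs_le] at hz
    exact hK z ⟨by linarith [hx.1, hz.1], by linarith [hx.2, hz.2]⟩ y
      ⟨by linarith [hy.1], by linarith [hy.2]⟩
  · set b := (1 - a) / 2 with hb
    have ham := S.ha
    have hb0 : 0 < b := by rw [hb]; linarith
    have hb1 : b < 1 := by rw [hb]; linarith
    refine ⟨(1 + a) / 2, by linarith, fun R hR => ?_⟩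
    rw [show (1 + a) / 2 - 1 - a = b - 1 by rw [hb]; ring]
    obtain ⟨m, hm0, hm⟩ := S.ux_loc (3 * R + 1)
    obtain ⟨K, hK0, hK⟩ := S.glip (3 * R + 1)
    set N := (2 * K + 1) / (1 - a) with hN
    have h1a : 0 < 1 - a := by linarith
    have hN0 : 0 ≤ N := by positivity
    have hN1 : N * (1 - a) = 2 * K + 1 := by rw [hN]; field_simp
    set R2 := 2 * R with hR2
    have hR20 : 0 < R2 := by positivity
    have hbb : 0 < b * (1 - b) := mul_pos hb0 (by linarith)
    have hRb : 0 < R2 ^ b := rpow_pos_of_pos hR20 b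
    obtain ⟨A, hA0, hA1, hA2⟩ : ∃ A : ℝ, 0 ≤ A ∧ 2 * m ≤ A * R2 ^ b ∧
      N * (2 * b) * R2 ^ b + 4 * m * (1 + a) / R2 ^ 2 * R2 ^ (2 - b) < A * (b * (1 - b)) := by
      obtain ⟨A, h1, h2, h3⟩ := ((eventually_ge_atTop (0:ℝ)).and
        ((eventually_ge_atTop (2 * m / R2 ^ b)).and (eventually_gt_atTop
          ((N * (2 * b) * R2 ^ b + 4 * m * (1 + a) / R2 ^ 2 * R2 ^ (2 - b)) / (b * (1 - b)))))).exists
      exact ⟨A, h1, (div_le_iff₀ hRb).1 h2, (div_lt_iff₀ hbb).1 h3⟩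
    set C := A + N * (4 * R ^ b) + 2 * m / R2 ^ 2 * (4 * R ^ (2 - b)) with hC
    have hC0 : 0 ≤ C := by positivity
    refine ⟨6 * (C + 1), by positivity, fun x hx t ht htR => ?_⟩
    have htb : 0 < t ^ b := rpow_pos_of_pos ht b
    have hone : ∀ s : ℝ, ∀ h, 0 < h → h < 1 → (s = 1 ∨ s = -1) →
        ∀ k ∈ Icc 0 (t / 2), ∀ y ∈ Icc (t / 2) (3 * t / 2),
        s * (h⁻¹ * (u (x + k + h) y - u (x + k) y)) - s * (h⁻¹ * (u (x - k + h) y - u (x - k) y))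
          ≤ C * t ^ b := by
      intro s h hh hh1 hs k hk y hy
      have hsabs : |s| = 1 := by rcases hs with h | h <;> simp [h]
      have hy0 : 0 ≤ y := by linarith [hy.1]
      have := holder_barrier S.ha ha hb ((S.har_h h).const_mul s)
        (Wy := fun z y => s * (h⁻¹ * (uy (z + h) y - uy z y)))
        (fun z y hy => (((S.dy (z + h) y hy).sub (S.dy z y hy)).const_mul h⁻¹).const_mul s)
        (x := x) (R := R2) (m := m) (K := K) (A := A) (N := N) hR20 ?_ ?_ hN0 (by linarith)
        hA0 hA1 hA2 k ⟨hk.1, by linarith [hk.2]⟩ y ⟨hy0, by linarith [hy.2]⟩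
      · refine this.trans ?_
        have f1 : k ^ b ≤ t ^ b := rpow_le_rpow hk.1 (by linarith [hk.2]) hb0.le
        have f2 : (k ^ 2 + y ^ 2) ^ b ≤ 4 * R ^ b * t ^ b := by
          calc (k ^ 2 + y ^ 2) ^ b ≤ (4 * (t * t)) ^ b := by
                apply rpow_le_rpow (by positivity) _ hb0.le
                nlinarith [hk.1, hk.2, hy.2]
            _ = 4 ^ b * (t ^ b * t ^ b) := by
                rw [mul_rpow (by norm_num) (by positivity), mul_rpow ht.le ht.le]
            _ ≤ 4 ^ (1:ℝ) * (R ^ b * t ^ b) := by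
                gcongr
                norm_num
            _ = _ := by rw [rpow_one]; ring
        have f3 : y ^ 2 ≤ 4 * R ^ (2 - b) * t ^ b := by
          calc y ^ 2 ≤ 4 * t ^ 2 := by nlinarith [hy.1, hy.2]
            _ = 4 * (t ^ (2 - b) * t ^ b) := by
                rw [← rpow_add ht]; congr 1; rw [← rpow_natCast]; congr 1; push_cast; ring
            _ ≤ 4 * (R ^ (2 - b) * t ^ b) := by
                gcongr
                linarith
            _ = _ := by ring
        have f4 : 0 ≤ y ^ (1 - a) := rpow_nonneg hy0 _
        calc A * k ^ b + N * ((k ^ 2 + y ^ 2) ^ b - y ^ (1 - a)) + 2 * m / R2 ^ 2 * y ^ 2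
            ≤ A * t ^ b + N * (4 * R ^ b * t ^ b) + 2 * m / R2 ^ 2 * (4 * R ^ (2 - b) * t ^ b) := by
              gcongr
              linarith
          _ = C * t ^ b := by rw [hC]; ring
      · intro z y hz hy
        rw [abs_mul, hsabs, one_mul]
        rw [abs_le] at hz
        have := S.mvt (z := z) (c := 0) (e := m) hh hy.1 fun z' hz' => by
          rw [sub_zero]
          exact hm z' ⟨by linarith [hx.1, hz.1, hz'.1], by linarith [hx.2, hz.2, hz'.2]⟩ y
            ⟨hy.1, by linarith [hy.2]⟩
        rw [sub_zero] at this
        exact this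
      · intro z hz
        rw [abs_le] at hz
        refine ⟨s * (h⁻¹ * (-(g (z + h)) - -(g z))), ?_, ?_⟩
        · rw [abs_mul, hsabs, one_mul, abs_mul, abs_of_pos (inv_pos.2 hh), inv_mul_le_iff₀ hh]
          have := hK (z + h) ⟨by linarith [hx.1, hz.1], by linarith [hx.2, hz.2]⟩ z
            ⟨by linarith [hx.1, hz.1], by linarith [hx.2, hz.2]⟩
          rw [add_sub_cancel_left, abs_of_pos hh] at this
          rw [show -(g (z + h)) - -(g z) = -(g (z + h) - g z) by ring, abs_neg]
          linarith
        · refine ((((S.neu (z + h)).sub (S.neu z)).const_mul h⁻¹).const_mul s).congr fun y => ?_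
          ring
    have := S.uxx_of_bound (x := x) (m := (C + 1) * t ^ b) ht (by positivity) one_pos ?_
    · refine this.trans (le_of_eq ?_)
      rw [rpow_sub_one ht.ne']; ring
    · intro h hh hh1 k hk y hy
      have h1 := hone 1 h hh hh1 (Or.inl rfl) k hk y hy
      have h2 := hone (-1) h hh hh1 (Or.inr rfl) k hk y hy
      rw [abs_le]
      constructor <;> linarith

end Sol

lemma lim_bound_aux {φ φ' : ℝ → ℝ} {L C κ T : ℝ} (hκ : 0 < κ)
    (hd : ∀ t, 0 < t → t ≤ T → HasDerivAt φ (φ' t) t)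
    (hb : ∀ t, 0 < t → t ≤ T → |φ' t| ≤ C * t ^ (κ - 1))
    (hl : Tendsto φ (nhdsWithin 0 (Ioi 0)) (nhds L)) {y : ℝ} (hy : 0 < y) (hyT : y ≤ T) :
    φ y - L ≤ C / κ * y ^ κ := by
  have hψ : ∀ t, 0 < t → t ≤ T → HasDerivAt (fun r => C / κ * r ^ κ - φ r)
      (C * t ^ (κ - 1) - φ' t) t := by
    intro t ht htT
    have h1 := ((hasDerivAt_rpow_const (p := κ) (Or.inl ht.ne')).const_mul (C / κ)).sub (hd t ht htT)
    refine h1.congr_deriv ?_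
    field_simp
  have h2 : ∀ ε ∈ Ioo 0 y, C / κ * ε ^ κ - φ ε ≤ C / κ * y ^ κ - φ y := by
    intro ε hε
    have : MonotoneOn (fun r => C / κ * r ^ κ - φ r) (Icc ε y) := by
      apply monotoneOn_of_hasDerivWithinAt_nonneg (convex_Icc _ _)
        (f' := fun t => C * t ^ (κ - 1) - φ' t)
      · intro t ht
        exact (hψ t (hε.1.trans_le ht.1) (ht.2.trans hyT)).continuousAt.continuousWithinAt
      · intro t ht
        rw [interior_Icc] at ht
        exact (hψ t (hε.1.trans ht.1) (ht.2.le.trans hyT)).hasDerivWithinAt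
      · intro t ht
        rw [interior_Icc] at ht
        have := (abs_le.1 (hb t (hε.1.trans ht.1) (ht.2.le.trans hyT))).2
        linarith
    exact this ⟨le_rfl, hε.2.le⟩ ⟨hε.2.le, le_rfl⟩ hε.2.le
  have h3 : Tendsto (fun ε => C / κ * ε ^ κ - φ ε) (nhdsWithin 0 (Ioi 0)) (nhds (C / κ * 0 - L)) := by
    refine Tendsto.sub ?_ hl
    apply Tendsto.const_mul
    have : ContinuousAt (fun ε : ℝ => ε ^ κ) 0 := continuousAt_rpow_const _ _ (Or.inr hκ.le)
    have h4 := this.tendsto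
    rw [zero_rpow hκ.ne'] at h4
    exact h4.mono_left nhdsWithin_le_nhds
  have h5 := le_of_tendsto h3 (b := C / κ * y ^ κ - φ y) (by
    filter_upwards [Ioo_mem_nhdsGT hy] with ε hε using h2 ε hε)
  linarith

lemma lim_bound {φ φ' : ℝ → ℝ} {L C κ T : ℝ} (hκ : 0 < κ)
    (hd : ∀ t, 0 < t → t ≤ T → HasDerivAt φ (φ' t) t)
    (hb : ∀ t, 0 < t → t ≤ T → |φ' t| ≤ C * t ^ (κ - 1))
    (hl : Tendsto φ (nhdsWithin 0 (Ioi 0)) (nhds L)) {y : ℝ} (hy : 0 < y) (hyT : y ≤ T) :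
    |φ y - L| ≤ C / κ * y ^ κ := by
  have h1 := lim_bound_aux hκ hd hb hl hy hyT
  have h2 := lim_bound_aux (φ := fun r => - φ r) (φ' := fun r => - φ' r) hκ
    (fun t h h' => (hd t h h').neg) (fun t h h' => by rw [abs_neg]; exact hb t h h') hl.neg hy hyT
  rw [abs_le]; constructor <;> linarith

lemma intble {φ : ℝ → ℝ} {Y C p q : ℝ} (hp : -1 < p) (hq : -1 < q)
    (hc : ContinuousOn φ (Ioc 0 Y)) (hY : 0 ≤ Y)
    (hb : ∀ t, 0 < t → t ≤ Y → |φ t| ≤ C * (t ^ p + t ^ q)) :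
    IntervalIntegrable φ volume 0 Y := by
  have h1 : IntervalIntegrable (fun t : ℝ => C * (t ^ p + t ^ q)) volume 0 Y :=
    ((intervalIntegral.intervalIntegrable_rpow' hp).add
      (intervalIntegral.intervalIntegrable_rpow' hq)).const_mul C
  refine h1.mono_fun' ?_ ?_
  · rw [uIoc_of_le hY]
    exact hc.aestronglyMeasurable measurableSet_Ioc
  · rw [uIoc_of_le hY]
    refine (ae_restrict_iff' measurableSet_Ioc).2 (Eventually.of_forall fun t ht => ?_)
    exact hb t ht.1 ht.2

namespace Sol
variable {a M : ℝ} {g : ℝ → ℝ} {u ux uy uxx uxy uyy : ℝ → ℝ → ℝ}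

lemma q_near (S : Sol a M g u ux uy uxx uxy uyy) :
    ∃ κ : ℝ, 0 < κ ∧ ∀ R > 0, ∃ C ≥ 0, ∀ x ∈ Icc (-R) R, ∀ t, 0 < t → t ≤ R →
      |t ^ a * uy x t + g x| ≤ C * t ^ κ ∧ |t ^ a * uxx x t| ≤ C * t ^ (κ - 1) := by
  obtain ⟨κ, hκ, h⟩ := S.uxx_near
  refine ⟨κ, hκ, fun R hR => ?_⟩
  obtain ⟨C, hC, h⟩ := h R hR
  have hq : ∀ x ∈ Icc (-R) R, ∀ t, 0 < t → t ≤ R → |t ^ a * uxx x t| ≤ C * t ^ (κ - 1) := by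
    intro x hx t ht htR
    rw [abs_mul, abs_of_pos (rpow_pos_of_pos ht a)]
    calc t ^ a * |uxx x t| ≤ t ^ a * (C * t ^ (κ - 1 - a)) := by
          have := rpow_pos_of_pos ht a
          gcongr
          exact h x hx t ht htR
      _ = C * (t ^ a * t ^ (κ - 1 - a)) := by ring
      _ = C * t ^ (κ - 1) := by rw [← rpow_add ht]; congr 2; ring
  refine ⟨max C (C / κ), le_max_of_le_left hC, fun x hx t ht htR => ⟨?_, ?_⟩⟩
  · have := lim_bound hκ (φ := fun r => r ^ a * uy x r) (T := R)
      (fun t ht _ => S.q_deriv (x := x) ht)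
      (fun t ht h' => by rw [abs_neg]; exact hq x hx t ht h') (S.neu x) ht htR
    rw [sub_neg_eq_add] at this
    refine this.trans ?_
    have := rpow_nonneg ht.le κ
    gcongr
    exact le_max_right _ _
  · refine (hq x hx t ht htR).trans ?_
    have := rpow_nonneg ht.le (κ - 1)
    gcongr
    exact le_max_left _ _

lemma q_bdd (S : Sol a M g u ux uy uxx uxy uyy) {R : ℝ} (hR : 0 < R) :
    ∃ K ≥ 0, ∀ x ∈ Icc (-R) R, ∀ t, 0 < t → t ≤ R → |t ^ a * uy x t| ≤ K := by
  obtain ⟨κ, hκ, h⟩ := S.q_near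
  obtain ⟨C, hC, h⟩ := h R hR
  obtain ⟨G, hG⟩ := S.gbdd
  refine ⟨C * R ^ κ + G, ?_, ?_⟩
  · have := (abs_nonneg _).trans (hG 0)
    positivity
  · intro x hx t ht htR
    have h1 := (h x hx t ht htR).1
    have h2 : C * t ^ κ ≤ C * R ^ κ := by gcongr
    have h3 := hG x
    have h4 : t ^ a * uy x t = (t ^ a * uy x t + g x) - g x := by ring
    rw [h4]
    exact (abs_sub _ _).trans (by linarith)

lemma dens_bdd (S : Sol a M g u ux uy uxx uxy uyy) {R : ℝ} (hR : 0 < R) :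
    ∃ K ≥ 0, ∀ x ∈ Icc (-R) R, ∀ t, 0 < t → t ≤ R →
      t ^ a * ux x t ^ 2 ≤ K * t ^ a ∧ t ^ a * uy x t ^ 2 ≤ K * t ^ (-a) := by
  obtain ⟨K1, hK1, h1⟩ := S.ux_loc R
  obtain ⟨K2, hK2, h2⟩ := S.q_bdd hR
  refine ⟨max (K1 ^ 2) (K2 ^ 2), le_max_of_le_left (sq_nonneg _), fun x hx t ht htR => ⟨?_, ?_⟩⟩
  · have h3 := h1 x hx t ⟨ht.le, htR⟩
    have h4 : ux x t ^ 2 ≤ K1 ^ 2 := by rw [← sq_abs]; gcongr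
    rw [mul_comm]
    have := rpow_pos_of_pos ht a
    gcongr
    exact h4.trans (le_max_left _ _)
  · have h3 := h2 x hx t ht htR
    have h4 : (t ^ a * uy x t) ^ 2 ≤ K2 ^ 2 := by rw [← sq_abs]; gcongr
    have h5 : t ^ a * uy x t ^ 2 = (t ^ a * uy x t) ^ 2 * t ^ (-a) := by
      rw [rpow_neg ht.le]
      have := (rpow_pos_of_pos ht a).ne'
      field_simp
    rw [h5]
    have := rpow_pos_of_pos ht (-a)
    gcongr
    exact h4.trans (le_max_right _ _)

lemma c_slice {F : ℝ → ℝ → ℝ} (h : ContinuousOn (fun p : ℝ × ℝ => F p.1 p.2) {p : ℝ × ℝ | 0 < p.2})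
    (x : ℝ) : ContinuousOn (fun t => F x t) (Ioi 0) :=
  h.comp (f := fun t : ℝ => (x, t)) (by fun_prop) (fun t ht => ht)

lemma c_slice' {F : ℝ → ℝ → ℝ} (h : ContinuousOn (fun p : ℝ × ℝ => F p.1 p.2) {p : ℝ × ℝ | 0 ≤ p.2})
    (x : ℝ) : ContinuousOn (fun t => F x t) (Ici 0) :=
  h.comp (f := fun t : ℝ => (x, t)) (by fun_prop) (fun t ht => ht)

lemma c_rpow (a : ℝ) : ContinuousOn (fun t : ℝ => t ^ a) (Ioi 0) := fun t ht =>
  (continuousAt_rpow_const _ _ (Or.inl (ne_of_gt ht))).continuousWithinAt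

lemma c_uxs (S : Sol a M g u ux uy uxx uxy uyy) (x : ℝ) : ContinuousOn (fun t => ux x t) (Ioi 0) :=
  (c_slice' S.cux x).mono Ioi_subset_Ici_self

lemma dens_cont (S : Sol a M g u ux uy uxx uxy uyy) (x : ℝ) :
    ContinuousOn (fun t => (1/2) * t ^ a * (ux x t ^ 2 - uy x t ^ 2)) (Ioi 0) :=
  ((c_rpow a).const_mul _ ).mul (((S.c_uxs x).pow 2).sub ((c_slice S.cuy x).pow 2))

lemma dens_le (S : Sol a M g u ux uy uxx uxy uyy) {R : ℝ} (hR : 0 < R) :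
    ∃ K ≥ 0, ∀ x ∈ Icc (-R) R, ∀ t, 0 < t → t ≤ R →
      |(1/2) * t ^ a * (ux x t ^ 2 - uy x t ^ 2)| ≤ K * (t ^ a + t ^ (-a)) := by
  obtain ⟨K, hK, h⟩ := S.dens_bdd hR
  refine ⟨K, hK, fun x hx t ht htR => ?_⟩
  obtain ⟨h1, h2⟩ := h x hx t ht htR
  have h3 : 0 ≤ t ^ a * ux x t ^ 2 := mul_nonneg (rpow_nonneg ht.le _) (sq_nonneg _)
  have h4 : 0 ≤ t ^ a * uy x t ^ 2 := mul_nonneg (rpow_nonneg ht.le _) (sq_nonneg _)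
  rw [abs_le]; constructor <;> linarith

lemma dens_int (S : Sol a M g u ux uy uxx uxy uyy) (x : ℝ) {Y : ℝ} (hY : 0 ≤ Y) :
    IntervalIntegrable (fun t => (1/2) * t ^ a * (ux x t ^ 2 - uy x t ^ 2)) volume 0 Y := by
  obtain ⟨K, hK, h⟩ := S.dens_le (R := |x| + Y + 1) (by positivity)
  have hx := abs_le.1 (le_refl |x|)
  refine intble S.ha (q := -a) (by linarith [S.ha']) ((S.dens_cont x).mono Ioc_subset_Ioi_self) hY
    (C := K) fun t ht htY => h x ⟨?_, ?_⟩ t ht ?_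
  · linarith [hx.1]
  · linarith [hx.2]
  · linarith [abs_nonneg x]

lemma dens_joint (S : Sol a M g u ux uy uxx uxy uyy) :
    ContinuousOn (fun p : ℝ × ℝ => ∫ t in (0:ℝ)..p.2, (1/2) * t ^ a * (ux p.1 t ^ 2 - uy p.1 t ^ 2))
      {p : ℝ × ℝ | 0 ≤ p.2} := by
  set F : ℝ → ℝ → ℝ := fun x => indicator (Ioi 0)
    (fun t => (1/2) * t ^ a * (ux x t ^ 2 - uy x t ^ 2)) with hF
  have Fpos : ∀ x t, 0 < t → F x t = (1/2) * t ^ a * (ux x t ^ 2 - uy x t ^ 2) :=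
    fun x t h0 => indicator_of_mem (show t ∈ Ioi (0:ℝ) from h0) _
  have Fneg : ∀ x t, ¬ 0 < t → F x t = 0 :=
    fun x t h0 => indicator_of_notMem (show t ∉ Ioi (0:ℝ) from h0) _
  have hEq : ∀ p ∈ {p : ℝ × ℝ | 0 ≤ p.2},
      (∫ t in (0:ℝ)..p.2, (1/2) * t ^ a * (ux p.1 t ^ 2 - uy p.1 t ^ 2)) =
        ∫ t in (0:ℝ)..p.2, F p.1 t := by
    intro p hp
    refine intervalIntegral.integral_congr_ae (Eventually.of_forall fun t ht => ?_)
    have hp' : 0 ≤ p.2 := hp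
    rw [uIoc_of_le hp'] at ht
    rw [Fpos _ _ ht.1]
  refine ContinuousOn.congr ?_ hEq
  rintro ⟨x0, y0⟩ hp
  have hy0 : 0 ≤ y0 := hp
  apply ContinuousAt.continuousWithinAt
  obtain ⟨K, hK, h⟩ := S.dens_le (R := |x0| + y0 + 1) (by positivity)
  have hx := abs_le.1 (le_refl |x0|)
  refine intervalIntegral.continuousAt_parametric_primitive_of_dominated (F := F)
    (fun t => K * (|t ^ a| + |t ^ (-a)|)) (-1) (y0 + 1) ?_ ?_ ?_ ?_ ?_ ?_ ?_
  · intro x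
    apply AEStronglyMeasurable.restrict
    rw [hF, aestronglyMeasurable_indicator_iff measurableSet_Ioi]
    exact (S.dens_cont x).aestronglyMeasurable measurableSet_Ioi
  · filter_upwards [Icc_mem_nhds (show x0 - 1 < x0 by linarith) (show x0 < x0 + 1 by linarith)]
      with x hx'
    rw [uIoc_of_le (by linarith)]
    refine (ae_restrict_iff' measurableSet_Ioc).2 (Eventually.of_forall fun t ht => ?_)
    by_cases h0 : 0 < t
    · rw [Fpos _ _ h0, Real.norm_eq_abs]
      have := h x ⟨by linarith [hx'.1, hx.1], by linarith [hx'.2, hx.2]⟩ t h0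
        (by linarith [ht.2, abs_nonneg x0])
      rwa [abs_of_pos (rpow_pos_of_pos h0 _), abs_of_pos (rpow_pos_of_pos h0 _)]
    · rw [Fneg _ _ h0, norm_zero]
      positivity
  · exact (((intervalIntegral.intervalIntegrable_rpow' S.ha).abs).add
      (intervalIntegral.intervalIntegrable_rpow' (by linarith [S.ha'])).abs).const_mul K
  · refine Eventually.of_forall fun t => ?_
    by_cases h0 : 0 < t
    · have : (fun x => F x t) = fun x => (1/2) * t ^ a * (ux x t ^ 2 - uy x t ^ 2) := by
        funext x
        rw [Fpos _ _ h0]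
      rw [this]
      have h1 : ContinuousAt (fun x => ux x t) x0 := (S.dxx x0 t h0).continuousAt
      have h2 : ContinuousAt (fun x => uy x t) x0 := (S.dyx x0 t h0).continuousAt
      fun_prop
    · have : (fun x => F x t) = fun x => 0 := by
        funext x
        rw [Fneg _ _ h0]
      rw [this]
      exact continuousAt_const
  · constructor <;> linarith
  · constructor <;> linarith
  · simp

end Sol

namespace Sol
variable {a M : ℝ} {g : ℝ → ℝ} {u ux uy uxx uxy uyy : ℝ → ℝ → ℝ}

lemma dens_dy (S : Sol a M g u ux uy uxx uxy uyy) (x : ℝ) {y : ℝ} (hy : 0 < y) :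
    HasDerivAt (fun r => ∫ t in (0:ℝ)..r, (1/2) * t ^ a * (ux x t ^ 2 - uy x t ^ 2))
      ((1/2) * y ^ a * (ux x y ^ 2 - uy x y ^ 2)) y :=
  intervalIntegral.integral_hasDerivAt_right (S.dens_int x hy.le)
    ((S.dens_cont x).stronglyMeasurableAtFilter isOpen_Ioi y hy)
    ((S.dens_cont x).continuousAt (Ioi_mem_nhds hy))

lemma dens_dx_eps (S : Sol a M g u ux uy uxx uxy uyy) (x : ℝ) {ε y : ℝ} (hε : 0 < ε) (hy : ε ≤ y) :
    HasDerivAt (fun x' => ∫ t in ε..y, (1/2) * t ^ a * (ux x' t ^ 2 - uy x' t ^ 2))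
      (ε ^ a * uy x ε * ux x ε - y ^ a * uy x y * ux x y) x := by
  have hsub : Icc (x - 1) (x + 1) ×ˢ Icc ε y ⊆ {p : ℝ × ℝ | 0 < p.2} :=
    fun p hp => hε.trans_le hp.2.1
  have hsub' : {p : ℝ × ℝ | 0 < p.2} ⊆ {p : ℝ × ℝ | 0 ≤ p.2} := fun p (hp : 0 < p.2) => hp.le
  have hc : ContinuousOn (fun p : ℝ × ℝ => p.2 ^ a * (ux p.1 p.2 * uxx p.1 p.2
      - uy p.1 p.2 * uxy p.1 p.2)) {p : ℝ × ℝ | 0 < p.2} := by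
    have h1 : ContinuousOn (fun p : ℝ × ℝ => p.2 ^ a) {p : ℝ × ℝ | 0 < p.2} :=
      (c_rpow a).comp continuousOn_snd (fun p hp => hp)
    exact h1.mul (((S.cux.mono hsub').mul S.cuxx).sub (S.cuy.mul S.cuxy))
  obtain ⟨K, hK⟩ := (isCompact_Icc.prod isCompact_Icc).exists_bound_of_continuousOn (hc.mono hsub)
  have hI : Icc ε y ⊆ Ioi 0 := fun t ht => hε.trans_le ht.1
  have hI' : uIoc ε y ⊆ Icc ε y := by rw [uIoc_of_le hy]; exact Ioc_subset_Icc_self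
  have hcs := c_slice (F := fun x t => t ^ a * (ux x t * uxx x t - uy x t * uxy x t)) hc x
  have key := intervalIntegral.hasDerivAt_integral_of_dominated_loc_of_deriv_le (μ := volume)
    (a := ε) (b := y)
    (F := fun x' t => (1/2) * t ^ a * (ux x' t ^ 2 - uy x' t ^ 2))
    (F' := fun x t => t ^ a * (ux x t * uxx x t - uy x t * uxy x t))
    (s := Icc (x - 1) (x + 1)) (x₀ := x) (bound := fun _ => K)
    (Icc_mem_nhds (by linarith) (by linarith))
    (Eventually.of_forall fun x' => ((S.dens_cont x').mono (hI'.trans hI)).aestronglyMeasurable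
      measurableSet_uIoc)
    (ContinuousOn.intervalIntegrable (by rw [uIcc_of_le hy]; exact (S.dens_cont x).mono hI))
    ((hcs.mono (hI'.trans hI)).aestronglyMeasurable measurableSet_uIoc)
    (Eventually.of_forall fun t ht x' hx' => hK (x', t) ⟨hx', hI' ht⟩)
    (by simp)
    (Eventually.of_forall fun t ht x' hx' => by
      have ht0 : 0 < t := hI (hI' ht)
      have h1 := (((S.dxx x' t ht0).fun_pow 2).sub ((S.dyx x' t ht0).fun_pow 2)).const_mul
        ((1/2) * t ^ a)
      refine h1.congr_deriv ?_
      push_cast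
      ring)
  refine key.2.congr_deriv ?_
  have h2 := intervalIntegral.integral_eq_sub_of_hasDerivAt (a := ε) (b := y)
    (f := fun t => -(t ^ a * uy x t * ux x t))
    (f' := fun t => t ^ a * (ux x t * uxx x t - uy x t * uxy x t))
    (fun t ht => by
      rw [uIcc_of_le hy] at ht
      have ht0 : 0 < t := hI ht
      refine (((S.q_deriv (x := x) ht0).fun_mul (S.dxy x t ht0)).fun_neg).congr_deriv ?_
      ring) key.1
  rw [h2]
  ring

lemma dens_dx (S : Sol a M g u ux uy uxx uxy uyy) (x : ℝ) {y : ℝ} (hy : 0 < y) :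
    HasDerivAt (fun x' => ∫ t in (0:ℝ)..y, (1/2) * t ^ a * (ux x' t ^ 2 - uy x' t ^ 2))
      (-(g x) * ux x 0 - y ^ a * uy x y * ux x y) x := by
  set R : ℝ := |x| + y + 1 with hR
  have hR0 : 0 < R := by positivity
  have hx := abs_le.1 (le_refl |x|)
  have hxR : x ∈ Ioo (-R) R := ⟨by linarith [hx.1], by linarith [hx.2]⟩
  obtain ⟨κ, hκ, hq⟩ := S.q_near
  obtain ⟨C, hC, hq⟩ := hq R hR0
  obtain ⟨K, hK0, hK⟩ := S.ux_loc R
  obtain ⟨G, hG⟩ := S.gbdd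
  have hG0 : 0 ≤ G := (abs_nonneg _).trans (hG 0)
  have huc : UniformContinuousOn (fun p : ℝ × ℝ => ux p.1 p.2) (Icc (-R) R ×ˢ Icc 0 R) :=
    (isCompact_Icc.prod isCompact_Icc).uniformContinuousOn_of_continuous
      (S.cux.mono fun p hp => hp.2.1)
  rw [Metric.uniformContinuousOn_iff] at huc
  refine hasDerivAt_of_tendstoUniformlyOn (l := nhdsWithin (0:ℝ) (Ioi 0)) (s := Ioo (-R) R)
    (f := fun ε x' => ∫ t in ε..y, (1/2) * t ^ a * (ux x' t ^ 2 - uy x' t ^ 2))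
    (f' := fun ε x => ε ^ a * uy x ε * ux x ε - y ^ a * uy x y * ux x y)
    (g' := fun x => -(g x) * ux x 0 - y ^ a * uy x y * ux x y) isOpen_Ioo ?_ ?_ ?_ hxR
  · rw [Metric.tendstoUniformlyOn_iff]
    intro e he
    obtain ⟨δ, hδ, huc⟩ := huc (e / (2 * (G + 1))) (by positivity)
    have hpow : Tendsto (fun ε : ℝ => C * ε ^ κ * K) (nhdsWithin 0 (Ioi 0)) (nhds 0) := by
      have : ContinuousAt (fun ε : ℝ => C * ε ^ κ * K) 0 :=
        ((continuousAt_rpow_const _ _ (Or.inr hκ.le)).const_mul C).mul_const K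
      have h4 := this.tendsto
      rw [zero_rpow hκ.ne', mul_zero, zero_mul] at h4
      exact h4.mono_left nhdsWithin_le_nhds
    filter_upwards [Ioo_mem_nhdsGT hδ, Ioo_mem_nhdsGT hR0, hpow.eventually
      (gt_mem_nhds (show (0:ℝ) < e / 2 by positivity))] with ε h1 h2 h3 z hz
    have hz' : z ∈ Icc (-R) R := ⟨hz.1.le, hz.2.le⟩
    have k1 := (hq z hz' ε h1.1 h2.2.le).1
    have k2 := hK z hz' ε ⟨h1.1.le, h2.2.le⟩
    have k3 := huc (z, ε) ⟨hz', h1.1.le, h2.2.le⟩ (z, 0) ⟨hz', le_rfl, hR0.le⟩ (by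
      rw [Prod.dist_eq, dist_self, Real.dist_eq, sub_zero, abs_of_pos h1.1]
      exact max_lt hδ h1.2)
    rw [Real.dist_eq] at k3 ⊢
    have e1 : -(g z) * ux z 0 - y ^ a * uy z y * ux z y - (ε ^ a * uy z ε * ux z ε
        - y ^ a * uy z y * ux z y) = g z * (ux z ε - ux z 0) - (ε ^ a * uy z ε + g z) * ux z ε := by
      ring
    rw [e1]
    refine (abs_sub _ _).trans_lt ?_
    rw [abs_mul, abs_mul]
    have k4 : |ε ^ a * uy z ε + g z| * |ux z ε| ≤ C * ε ^ κ * K :=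
      mul_le_mul k1 k2 (abs_nonneg _) ((abs_nonneg _).trans k1)
    have k5 : |g z| * |ux z ε - ux z 0| ≤ (G + 1) * (e / (2 * (G + 1))) := by
      apply mul_le_mul _ k3.le (abs_nonneg _) (by positivity)
      linarith [hG z]
    have k6 : (G + 1) * (e / (2 * (G + 1))) = e / 2 := by field_simp
    linarith
  · filter_upwards [Ioo_mem_nhdsGT hy] with ε hε z hz using S.dens_dx_eps z hε.1 hε.2.le
  · intro z hz
    have h1 : Tendsto (fun ε => ∫ t in (0:ℝ)..ε, (1/2) * t ^ a * (ux z t ^ 2 - uy z t ^ 2))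
        (nhdsWithin 0 (Ioi 0)) (nhds 0) := by
      have h2 := (c_slice' (F := fun x y => ∫ t in (0:ℝ)..y,
        (1/2) * t ^ a * (ux x t ^ 2 - uy x t ^ 2)) S.dens_joint z) 0 (show (0:ℝ) ≤ 0 from le_rfl)
      have h3 := h2.tendsto.mono_left (nhdsWithin_mono 0 Ioi_subset_Ici_self)
      rw [intervalIntegral.integral_same] at h3
      exact h3
    have h2 := (tendsto_const_nhds (x := ∫ t in (0:ℝ)..y,
      (1/2) * t ^ a * (ux z t ^ 2 - uy z t ^ 2))).sub h1
    rw [sub_zero] at h2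
    refine h2.congr' ?_
    filter_upwards [Ioo_mem_nhdsGT hy] with ε hε
    exact intervalIntegral.integral_interval_sub_left (S.dens_int z hy.le) (S.dens_int z hε.1.le)

end Sol

/-- The Hamiltonian defect. -/
noncomputable def Ph (a : ℝ) (A : ℝ → ℝ) (ux uy : ℝ → ℝ → ℝ) (x y : ℝ) : ℝ :=
  A x - (1 + a) * ∫ t in (0:ℝ)..y, (1/2) * t ^ a * (ux x t ^ 2 - uy x t ^ 2)

namespace Sol
variable {a M : ℝ} {g : ℝ → ℝ} {u ux uy uxx uxy uyy : ℝ → ℝ → ℝ} {A : ℝ → ℝ}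

lemma Ph_zero (x : ℝ) : Ph a A ux uy x 0 = A x := by
  simp [Ph]

lemma Ph_dx (S : Sol a M g u ux uy uxx uxy uyy)
    (hA : ∀ x, HasDerivAt A (-((1 + a) * g x * ux x 0)) x) (x : ℝ) {y : ℝ} (hy : 0 < y) :
    HasDerivAt (fun x' => Ph a A ux uy x' y) ((1 + a) * (y ^ a * uy x y * ux x y)) x := by
  refine ((hA x).sub ((S.dens_dx x hy).const_mul (1 + a))).congr_deriv ?_
  ring

lemma Ph_dy (S : Sol a M g u ux uy uxx uxy uyy) (x : ℝ) {y : ℝ} (hy : 0 < y) :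
    HasDerivAt (fun r => Ph a A ux uy x r)
      (-((1 + a) * ((1/2) * y ^ a * (ux x y ^ 2 - uy x y ^ 2)))) y :=
  ((S.dens_dy x hy).const_mul (1 + a)).const_sub (A x)

lemma Ph_cont (S : Sol a M g u ux uy uxx uxy uyy)
    (hA : ∀ x, HasDerivAt A (-((1 + a) * g x * ux x 0)) x) :
    ContinuousOn (fun p : ℝ × ℝ => Ph a A ux uy p.1 p.2) {p : ℝ × ℝ | 0 ≤ p.2} := by
  have h1 : Continuous A := continuous_iff_continuousAt.2 fun x => (hA x).continuousAt
  exact (h1.comp continuous_fst).continuousOn.sub (S.dens_joint.const_mul (1 + a))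

lemma no_min_int (S : Sol a M g u ux uy uxx uxy uyy) (hpos : ∀ x, 0 < ux x 0)
    (hA : ∀ x, HasDerivAt A (-((1 + a) * g x * ux x 0)) x) {x y : ℝ} (hy : 0 < y)
    (hx : IsLocalMin (fun x' => Ph a A ux uy x' y) x)
    (hy' : IsLocalMin (fun r => Ph a A ux uy x r) y) : False := by
  have h1 := hx.hasDerivAt_eq_zero (S.Ph_dx hA x hy)
  have h2 := hy'.hasDerivAt_eq_zero (S.Ph_dy x hy)
  have h3 := S.ux_pos hpos (x := x) hy.le
  have h4 : 0 < 1 + a := by linarith [S.ha]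
  have h5 := rpow_pos_of_pos hy a
  have h6 : uy x y = 0 := by
    have : (1 + a) * (y ^ a * uy x y * ux x y) = ((1 + a) * y ^ a * ux x y) * uy x y := by ring
    rw [this] at h1
    exact (mul_eq_zero.1 h1).resolve_left (by positivity)
  rw [h6] at h2
  have : 0 < (1 + a) * (1 / 2 * y ^ a * (ux x y ^ 2 - 0 ^ 2)) := by
    have : 0 < ux x y ^ 2 - 0 ^ 2 := by simp only [ne_eq, OfNat.ofNat_ne_zero,
      not_false_eq_true, zero_pow, sub_zero]; positivity
    positivity
  linarith

lemma uy_small (S : Sol a M g u ux uy uxx uxy uyy) {x : ℝ} (hpos : 0 < ux x 0) (hg : g x = 0) :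
    ∃ d > 0, ∀ y, 0 < y → y ≤ d → |uy x y| < ux x y := by
  set c := ux x 0 with hc
  set e := min (c / 4) (|a| * c / 48 + if a ≤ 0 then 1 else 0) with he
  have he0 : 0 < e := by
    apply lt_min (by positivity)
    split_ifs with h
    · positivity
    · push Not at h
      have := abs_pos.2 h.ne'
      positivity
  have hec : e ≤ c / 4 := min_le_left _ _
  obtain ⟨δ, hδ, hcl⟩ : ∃ δ > 0, ∀ z y, |z - x| ≤ δ → 0 ≤ y → y ≤ δ → |ux z y - c| ≤ e := by
    have h1 := Metric.continuousOn_iff.1 S.cux (x, 0) (show (0:ℝ) ≤ 0 from le_rfl) e he0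
    obtain ⟨δ, hδ, h1⟩ := h1
    refine ⟨δ / 2, by positivity, fun z y hz hy hy' => ?_⟩
    have h2 := h1 (z, y) hy (by
      rw [Prod.dist_eq, Real.dist_eq, Real.dist_eq, sub_zero, abs_of_nonneg hy]
      exact max_lt (by linarith) (by linarith))
    exact h2.le
  have huxx : ∀ t, 0 < t → t ≤ δ / 2 → |uxx x t| ≤ 12 * e / t := by
    intro t ht htd
    refine S.uxx_osc ht he0 (c := c) fun z y hz hy => ?_
    exact hcl z y (by linarith) (by linarith [hy.1]) (by linarith [hy.2])
  have hlow : ∀ y, 0 < y → y ≤ δ → 3 * c / 4 ≤ ux x y := by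
    intro y h h'
    have := (abs_le.1 (hcl x y (by simpa using hδ.le) h.le h')).1
    linarith
  have hn := S.neu x
  rw [hg, neg_zero] at hn
  rcases le_or_gt a 0 with ha | ha
  · have h1 := hn.abs
    rw [abs_zero] at h1
    have h2 := (h1.eventually (gt_mem_nhds (show (0:ℝ) < c / 4 by positivity)))
    obtain ⟨d, hd, h2⟩ := (mem_nhdsGT_iff_exists_Ioo_subset.1 h2)
    have hd0 : 0 < d := hd
    refine ⟨min (d / 2) (min δ 1), by positivity, fun y hy hyd => ?_⟩
    have k1 : |y ^ a * uy x y| < c / 4 :=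
      h2 ⟨hy, by linarith [min_le_left (d / 2) (min δ 1)]⟩
    have k2 := min_le_right (d / 2) (min δ 1)
    have k3 := hlow y hy (hyd.trans (k2.trans (min_le_left _ _)))
    have k4 : 1 ≤ y ^ a :=
      one_le_rpow_of_pos_of_le_one_of_nonpos hy (hyd.trans (k2.trans (min_le_right _ _))) ha
    rw [abs_mul, abs_of_pos (by linarith : 0 < y ^ a)] at k1
    nlinarith [abs_nonneg (uy x y)]
  · have hea : e ≤ a * c / 48 := by
      have : e ≤ _ := min_le_right _ _
      rwa [if_neg (by linarith), add_zero, abs_of_pos ha] at this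
    refine ⟨δ / 2, by positivity, fun y hy hyd => ?_⟩
    have k3 := hlow y hy (by linarith)
    have k5 := lim_bound ha (φ := fun r => r ^ a * uy x r) (T := δ / 2) (C := 12 * e)
      (fun t ht _ => S.q_deriv (x := x) ht) (fun t ht h' => by
        rw [abs_neg, abs_mul, abs_of_pos (rpow_pos_of_pos ht a), rpow_sub_one ht.ne']
        have := mul_le_mul_of_nonneg_left (huxx t ht h') (rpow_pos_of_pos ht a).le
        refine this.trans (le_of_eq ?_)
        ring) hn hy hyd
    have hya := rpow_pos_of_pos hy a
    rw [sub_zero, abs_mul, abs_of_pos hya, mul_comm] at k5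
    have k6 := le_of_mul_le_mul_right k5 hya
    have k7 : 12 * e / a ≤ c / 4 := by
      rw [div_le_iff₀ ha]
      linarith
    linarith

lemma no_min_bot (S : Sol a M g u ux uy uxx uxy uyy) (hpos : ∀ x, 0 < ux x 0)
    (hA : ∀ x, HasDerivAt A (-((1 + a) * g x * ux x 0)) x) {x δ : ℝ} (hδ : 0 < δ)
    (hx : IsLocalMin A x)
    (hy : ∀ y, 0 ≤ y → y ≤ δ → Ph a A ux uy x 0 ≤ Ph a A ux uy x y) : False := by
  have h4 : 0 < 1 + a := by linarith [S.ha]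
  have hg : g x = 0 := by
    have h1 := hx.hasDerivAt_eq_zero (hA x)
    have h2 : ((1 + a) * ux x 0) * g x = 0 := by linarith
    have := hpos x
    exact (mul_eq_zero.1 h2).resolve_left (by positivity)
  obtain ⟨d, hd, hs⟩ := S.uy_small (hpos x) hg
  have hm : 0 < min d δ := by positivity
  have hanti : StrictAntiOn (fun r => Ph a A ux uy x r) (Icc 0 (min d δ)) := by
    apply strictAntiOn_of_hasDerivWithinAt_neg (convex_Icc _ _)
      (f' := fun y => (-((1 + a) * ((1/2) * y ^ a * (ux x y ^ 2 - uy x y ^ 2)))))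
    · exact (c_slice' (S.Ph_cont hA) x).mono Icc_subset_Ici_self
    · intro y hy
      rw [interior_Icc] at hy
      exact (S.Ph_dy x hy.1).hasDerivWithinAt
    · intro y hy
      rw [interior_Icc] at hy
      have h1 := hs y hy.1 (hy.2.le.trans (min_le_left _ _))
      have h2 : 0 < ux x y ^ 2 - uy x y ^ 2 := by
        have := sq_lt_sq' (by linarith [abs_nonneg (uy x y)]) h1
        rw [sq_abs] at this
        linarith
      have h5 := rpow_pos_of_pos hy.1 a
      have : 0 < (1 + a) * ((1/2) * y ^ a * (ux x y ^ 2 - uy x y ^ 2)) := by positivity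
      linarith
  have h1 := hanti ⟨le_rfl, hm.le⟩ ⟨hm.le, le_rfl⟩ hm
  have h2 := hy (min d δ) hm.le (min_le_right _ _)
  exact absurd h1 (not_lt.2 h2)

end Sol

namespace Sol
variable {a M : ℝ} {g : ℝ → ℝ} {u ux uy uxx uxy uyy : ℝ → ℝ → ℝ} {A : ℝ → ℝ}

lemma far_bds (S : Sol a M g u ux uy uxx uxy uyy) (x : ℝ) {y : ℝ} (hy : 0 < y) :
    |(1 + a) * (y ^ a * uy x y * ux x y)| ≤ (1 + a) * (580 * M) ^ 2 * y ^ (a - 2) ∧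
    |(1 + a) * ((1/2) * y ^ a * (ux x y ^ 2 - uy x y ^ 2))| ≤
      (1 + a) * (580 * M) ^ 2 * y ^ (a - 2) := by
  have hM := S.hM
  have h4 : 0 < 1 + a := by linarith [S.ha]
  have hya := rpow_pos_of_pos hy a
  have h1 : |ux x y| ≤ 580 * M / y := (S.ux_far hy).trans (by gcongr; norm_num)
  have h2 : |uy x y| ≤ 580 * M / y := S.uy_far hy
  have h3 : (1 + a) * (580 * M) ^ 2 * y ^ (a - 2) = (1 + a) * (y ^ a * (580 * M / y) ^ 2) := by
    rw [show a - 2 = a - (2:ℕ) by norm_num, rpow_sub_natCast hy.ne']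
    field_simp
  rw [h3]
  generalize 580 * M / y = B at h1 h2
  have hB : 0 ≤ B := (abs_nonneg _).trans h1
  constructor
  · rw [abs_mul, abs_of_pos h4, mul_assoc (y ^ a), abs_mul (y ^ a), abs_of_pos hya, abs_mul, sq]
    gcongr
  · rw [abs_mul, abs_of_pos h4, mul_assoc, abs_mul, abs_mul, abs_of_pos hya,
      abs_of_pos (by norm_num : (0:ℝ) < 1/2)]
    have k1 : ux x y ^ 2 ≤ B ^ 2 := by rw [← sq_abs]; gcongr
    have k2 : uy x y ^ 2 ≤ B ^ 2 := by rw [← sq_abs]; gcongr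
    have k3 : |ux x y ^ 2 - uy x y ^ 2| ≤ B ^ 2 := by
      rw [abs_le]; constructor <;> nlinarith [sq_nonneg (ux x y), sq_nonneg (uy x y)]
    have k4 : 0 ≤ y ^ a * |ux x y ^ 2 - uy x y ^ 2| := by positivity
    apply mul_le_mul_of_nonneg_left _ h4.le
    nlinarith [mul_le_mul_of_nonneg_left k3 hya.le]

lemma decay_aux {φ φ' : ℝ → ℝ} {C a Y Z : ℝ} (hC : 0 ≤ C) (ha : a < 1) (hY : 0 < Y) (hYZ : Y ≤ Z)
    (hd : ∀ y, 0 < y → HasDerivAt φ (φ' y) y)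
    (hb : ∀ y, 0 < y → |φ' y| ≤ C * y ^ (a - 2)) : φ Z - φ Y ≤ C / (1 - a) * Y ^ (a - 1) := by
  have ha1 : 0 < 1 - a := by linarith
  have hψ : ∀ t, 0 < t → HasDerivAt (fun r => -(C / (1 - a)) * r ^ (a - 1) - φ r)
      (C * t ^ (a - 2) - φ' t) t := by
    intro t ht
    have h1 := ((hasDerivAt_rpow_const (p := a - 1) (Or.inl ht.ne')).const_mul
      (-(C / (1 - a)))).sub (hd t ht)
    refine h1.congr_deriv ?_
    rw [show a - 1 - 1 = a - 2 by ring]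
    field_simp
    ring
  have : MonotoneOn (fun r => -(C / (1 - a)) * r ^ (a - 1) - φ r) (Icc Y Z) := by
    apply monotoneOn_of_hasDerivWithinAt_nonneg (convex_Icc _ _)
      (f' := fun t => C * t ^ (a - 2) - φ' t)
    · intro t ht
      exact (hψ t (hY.trans_le ht.1)).continuousAt.continuousWithinAt
    · intro t ht
      rw [interior_Icc] at ht
      exact (hψ t (hY.trans ht.1)).hasDerivWithinAt
    · intro t ht
      rw [interior_Icc] at ht
      have := (abs_le.1 (hb t (hY.trans ht.1))).2
      linarith
  have h1 := this ⟨le_rfl, hYZ⟩ ⟨hYZ, le_rfl⟩ hYZ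
  have h2 : 0 ≤ C / (1 - a) * Z ^ (a - 1) := by
    have := rpow_nonneg (hY.le.trans hYZ) (a - 1)
    positivity
  have h1' : -(C / (1 - a)) * Y ^ (a - 1) - φ Y ≤ -(C / (1 - a)) * Z ^ (a - 1) - φ Z := h1
  linarith

lemma Ph_osc (S : Sol a M g u ux uy uxx uxy uyy)
    (hA : ∀ x, HasDerivAt A (-((1 + a) * g x * ux x 0)) x) :
    ∃ C ≥ 0, ∀ Y > 0, ∀ x x', |Ph a A ux uy x Y - Ph a A ux uy x' Y| ≤ C * Y ^ (a - 1) := by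
  have hM := S.hM
  have h4 : 0 < 1 + a := by linarith [S.ha]
  have ha1 : 0 < 1 - a := by linarith [S.ha']
  set C := (1 + a) * (580 * M) ^ 2 with hC
  have hC0 : 0 ≤ C := by positivity
  refine ⟨2 * (C / (1 - a)), by positivity, fun Y hY => ?_⟩
  have hv : ∀ x Z, Y ≤ Z → |Ph a A ux uy x Z - Ph a A ux uy x Y| ≤ C / (1 - a) * Y ^ (a - 1) := by
    intro x Z hZ
    have k1 := decay_aux (φ := fun r => Ph a A ux uy x r) hC0 S.ha' hY hZ
      (fun y hy => S.Ph_dy x hy) (fun y hy => by rw [abs_neg]; exact (S.far_bds x hy).2)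
    have k2 := decay_aux (φ := fun r => -Ph a A ux uy x r) hC0 S.ha' hY hZ
      (fun y hy => (S.Ph_dy x hy).neg)
      (fun y hy => by rw [neg_neg]; exact (S.far_bds x hy).2)
    rw [abs_le]; constructor <;> linarith
  have hh : ∀ x x' Z, 0 < Z → |Ph a A ux uy x Z - Ph a A ux uy x' Z| ≤ C * Z ^ (a - 2) * |x - x'| := by
    intro x x' Z hZ
    exact Convex.norm_image_sub_le_of_norm_hasDerivWithin_le (s := univ)
      (f := fun x => Ph a A ux uy x Z)
      (fun z _ => (S.Ph_dx hA z hZ).hasDerivWithinAt)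
      (fun z _ => (S.far_bds z hZ).1) convex_univ (mem_univ x') (mem_univ x)
  intro x x'
  have hlim : Tendsto (fun Z : ℝ => 2 * (C / (1 - a)) * Y ^ (a - 1) + C * Z ^ (a - 2) * |x - x'|)
      atTop (nhds (2 * (C / (1 - a)) * Y ^ (a - 1) + C * 0 * |x - x'|)) := by
    have := tendsto_rpow_neg_atTop (show 0 < 2 - a by linarith)
    rw [neg_sub] at this
    exact tendsto_const_nhds.add ((this.const_mul C).mul_const _)
  rw [mul_zero, zero_mul, add_zero] at hlim
  refine ge_of_tendsto hlim ?_
  filter_upwards [eventually_ge_atTop Y] with Z hZ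
  have k1 := abs_le.1 (hv x Z hZ)
  have k2 := abs_le.1 (hv x' Z hZ)
  have k3 := abs_le.1 (hh x x' Z (hY.trans_le hZ))
  rw [abs_le]; constructor <;> linarith [k1.1, k1.2, k2.1, k2.2, k3.1, k3.2]

end Sol

lemma param_deriv {F F' : ℝ → ℝ → ℝ} {Y C p q x : ℝ} (hp : -1 < p) (hq : -1 < q) (hY : 0 ≤ Y)
    (hF : ∀ z, ContinuousOn (F z) (Ioi 0)) (hF' : ContinuousOn (F' x) (Ioi 0))
    (hI : IntervalIntegrable (F x) volume 0 Y)
    (hb : ∀ z ∈ Icc (x - 1) (x + 1), ∀ t, 0 < t → t ≤ Y → |F' z t| ≤ C * (t ^ p + t ^ q))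
    (hd : ∀ z t, 0 < t → HasDerivAt (fun z => F z t) (F' z t) z) :
    IntervalIntegrable (F' x) volume 0 Y ∧
      HasDerivAt (fun z => ∫ t in (0:ℝ)..Y, F z t) (∫ t in (0:ℝ)..Y, F' x t) x := by
  have hsub : uIoc 0 Y ⊆ Ioi 0 := by rw [uIoc_of_le hY]; exact Ioc_subset_Ioi_self
  refine intervalIntegral.hasDerivAt_integral_of_dominated_loc_of_deriv_le (μ := volume)
    (s := Icc (x - 1) (x + 1)) (bound := fun t => C * (t ^ p + t ^ q))
    (Icc_mem_nhds (by linarith) (by linarith))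
    (Eventually.of_forall fun z => ((hF z).mono hsub).aestronglyMeasurable measurableSet_uIoc)
    hI ((hF'.mono hsub).aestronglyMeasurable measurableSet_uIoc)
    (Eventually.of_forall fun t ht z hz => ?_) ?_ (Eventually.of_forall fun t ht z hz => ?_)
  · rw [uIoc_of_le hY] at ht
    exact hb z hz t ht.1 ht.2
  · exact ((intervalIntegral.intervalIntegrable_rpow' hp).add
      (intervalIntegral.intervalIntegrable_rpow' hq)).const_mul C
  · exact hd z t (hsub ht)

lemma grow {φ φ' : ℝ → ℝ} {X c : ℝ} (hd : ∀ x, HasDerivAt φ (φ' x) x)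
    (hb : ∀ x, X ≤ x → c ≤ φ' x) {x : ℝ} (hx : X ≤ x) : φ X + c * (x - X) ≤ φ x := by
  have h1 : MonotoneOn (fun r => φ r - c * r) (Ici X) := by
    apply monotoneOn_of_hasDerivWithinAt_nonneg (convex_Ici _) (f' := fun t => φ' t - c)
    · intro t _
      exact ((hd t).continuousAt.sub (by fun_prop)).continuousWithinAt
    · intro t _
      have h := (hd t).sub ((hasDerivAt_id' t).const_mul c)
      exact (h.congr_deriv (by ring)).hasDerivWithinAt
    · intro t ht
      rw [interior_Ici] at ht
      have := hb t (le_of_lt ht)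
      linarith
  have h2 : φ X - c * X ≤ φ x - c * x := h1 (show X ≤ X from le_rfl) (show X ≤ x from hx) hx
  linarith

lemma freq_top {E E1 E2 : ℝ → ℝ} {B η : ℝ} (hη : 0 < η) (hB : ∀ x, |E x| ≤ B)
    (h1 : ∀ x, HasDerivAt E (E1 x) x) (h2 : ∀ x, HasDerivAt E1 (E2 x) x) :
    ∃ᶠ x in atTop, E2 x < η := by
  intro hcon
  obtain ⟨X, hX⟩ := eventually_atTop.1 hcon
  have k1 : ∀ x, X ≤ x → E1 X + η * (x - X) ≤ E1 x := fun x hx =>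
    grow h2 (fun x hx => not_lt.1 (hX x hx)) hx
  set X1 := X + |E1 X - 1| / η with hX1
  have hXX : X ≤ X1 := by
    have : 0 ≤ |E1 X - 1| / η := by positivity
    linarith
  have k2 : ∀ x, X1 ≤ x → 1 ≤ E1 x := by
    intro x hx
    have h3 := k1 x (hXX.trans hx)
    have h4 : η * (x - X) ≥ η * (|E1 X - 1| / η) := by
      apply mul_le_mul_of_nonneg_left _ hη.le
      linarith
    rw [mul_div_cancel₀ _ hη.ne'] at h4
    have := neg_abs_le (E1 X - 1)
    linarith
  have hB0 : 0 ≤ B := (abs_nonneg _).trans (hB 0)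
  have h3 := grow h1 k2 (x := X1 + 2 * B + 1) (by linarith)
  have h4 := abs_le.1 (hB X1)
  have h5 := abs_le.1 (hB (X1 + 2 * B + 1))
  linarith [h4.1, h5.2]

lemma freq_bot {E E1 E2 : ℝ → ℝ} {B η : ℝ} (hη : 0 < η) (hB : ∀ x, |E x| ≤ B)
    (h1 : ∀ x, HasDerivAt E (E1 x) x) (h2 : ∀ x, HasDerivAt E1 (E2 x) x) :
    ∃ᶠ x in atBot, E2 x < η := by
  have := freq_top (E := fun x => E (-x)) (E1 := fun x => -E1 (-x)) (E2 := fun x => E2 (-x)) hη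
    (fun x => hB (-x))
    (fun x => ((h1 (-x)).comp x (hasDerivAt_neg x)).congr_deriv (by ring))
    (fun x => (((h2 (-x)).comp x (hasDerivAt_neg x)).fun_neg).congr_deriv (by ring))
  exact tendsto_neg_atTop_atBot.frequently this

namespace Sol
variable {a M : ℝ} {g : ℝ → ℝ} {u ux uy uxx uxy uyy : ℝ → ℝ → ℝ} {A : ℝ → ℝ}

lemma c_us (S : Sol a M g u ux uy uxx uxy uyy) (x : ℝ) : ContinuousOn (fun t => u x t) (Ioi 0) :=
  (c_slice' S.cu x).mono Ioi_subset_Ici_self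

lemma energy (S : Sol a M g u ux uy uxx uxy uyy) {Y : ℝ} (hY : 0 < Y) (ℓ : ℝ) :
    ∃ E E1 : ℝ → ℝ, ∃ B : ℝ, (∀ x, |E x| ≤ B) ∧ (∀ x, HasDerivAt E (E1 x) x) ∧
      ∀ x, HasDerivAt E1 ((∫ t in (0:ℝ)..Y, (t ^ a * ux x t ^ 2 + t ^ a * uy x t ^ 2))
        - ((u x Y - ℓ) * (Y ^ a * uy x Y) + (u x 0 - ℓ) * g x)) x := by
  have hM := S.hM
  have ha := S.ha
  have ha' := S.ha'
  obtain ⟨κ, hκ, hq⟩ := S.q_near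
  have hbu : ∀ x t, 0 < t → |u x t - ℓ| ≤ M + |ℓ| := fun x t ht =>
    (abs_sub _ _).trans (by linarith [S.bdd x t ht.le])
  set L := M + |ℓ| with hL
  have hL0 : 0 ≤ L := by positivity
  have hc0 : ∀ x, ContinuousOn (fun t => t ^ a * ((u x t - ℓ) ^ 2 / 2)) (Ioi 0) := fun x =>
    (c_rpow a).mul ((((S.c_us x).sub continuousOn_const).pow 2).div_const 2)
  have hc1 : ∀ x, ContinuousOn (fun t => t ^ a * ((u x t - ℓ) * ux x t)) (Ioi 0) := fun x =>
    (c_rpow a).mul (((S.c_us x).sub continuousOn_const).mul (S.c_uxs x))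
  have hc2 : ∀ x, ContinuousOn (fun t => t ^ a * (ux x t ^ 2 + (u x t - ℓ) * uxx x t)) (Ioi 0) :=
    fun x => (c_rpow a).mul (((S.c_uxs x).pow 2).add
      (((S.c_us x).sub continuousOn_const).mul (c_slice S.cuxx x)))
  have hb0 : ∀ x t, 0 < t → |t ^ a * ((u x t - ℓ) ^ 2 / 2)| ≤ L ^ 2 * (t ^ a + t ^ a) := by
    intro x t ht
    have h1 := rpow_pos_of_pos ht a
    have h2 : (u x t - ℓ) ^ 2 ≤ L ^ 2 := by rw [← sq_abs]; gcongr; exact hbu x t ht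
    rw [abs_of_nonneg (by positivity)]
    nlinarith [mul_le_mul_of_nonneg_left h2 h1.le, sq_nonneg L, mul_nonneg h1.le (sq_nonneg L)]
  have hloc : ∀ x, ∃ C, ∀ z ∈ Icc (x - 1) (x + 1), ∀ t, 0 < t → t ≤ Y →
      |t ^ a * ((u z t - ℓ) * ux z t)| ≤ C * (t ^ a + t ^ a) ∧
      |t ^ a * (ux z t ^ 2 + (u z t - ℓ) * uxx z t)| ≤ C * (t ^ a + t ^ (κ - 1)) := by
    intro x
    set R := |x| + Y + 1 with hR
    have hR0 : 0 < R := by positivity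
    have hx := abs_le.1 (le_refl |x|)
    obtain ⟨C, hC, hq⟩ := hq R hR0
    obtain ⟨K, hK0, hK⟩ := S.ux_loc R
    refine ⟨L * K + K ^ 2 + L * C, fun z hz t ht htY => ?_⟩
    have hzR : z ∈ Icc (-R) R := ⟨by linarith [hz.1, hx.1], by linarith [hz.2, hx.2]⟩
    have htR : t ≤ R := by linarith [abs_nonneg x]
    have k1 := (hq z hzR t ht htR).2
    have k2 := hK z hzR t ⟨ht.le, htR⟩
    have k3 := hbu z t ht
    have h1 := rpow_pos_of_pos ht a
    have h2 := rpow_pos_of_pos ht (κ - 1)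
    have m1 : 0 ≤ L * K := by positivity
    have m2 : 0 ≤ L * C := by positivity
    constructor
    · rw [abs_mul, abs_of_pos h1, abs_mul]
      have : |u z t - ℓ| * |ux z t| ≤ L * K := by gcongr
      nlinarith [mul_le_mul_of_nonneg_left this h1.le, mul_nonneg m1 h1.le, mul_nonneg m2 h1.le,
        mul_nonneg (sq_nonneg K) h1.le]
    · have e1 : t ^ a * (ux z t ^ 2 + (u z t - ℓ) * uxx z t) =
          t ^ a * ux z t ^ 2 + (u z t - ℓ) * (t ^ a * uxx z t) := by ring
      rw [e1]
      refine (abs_add_le _ _).trans ?_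
      rw [abs_mul (u z t - ℓ)]
      have n1 : |u z t - ℓ| * |t ^ a * uxx z t| ≤ L * (C * t ^ (κ - 1)) := by gcongr
      have n2 : |t ^ a * ux z t ^ 2| ≤ t ^ a * K ^ 2 := by
        rw [abs_mul, abs_of_pos h1, abs_of_nonneg (sq_nonneg _), ← sq_abs]
        gcongr
      nlinarith [mul_nonneg m1 h1.le, mul_nonneg m2 h1.le, mul_nonneg (sq_nonneg K) h1.le,
        mul_nonneg m1 h2.le, mul_nonneg m2 h2.le, mul_nonneg (sq_nonneg K) h2.le]
  have hκ1 : -1 < κ - 1 := by linarith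
  have hI0 : ∀ x, IntervalIntegrable (fun t => t ^ a * ((u x t - ℓ) ^ 2 / 2)) volume 0 Y := fun x =>
    intble ha ha ((hc0 x).mono Ioc_subset_Ioi_self) hY.le fun t ht _ => hb0 x t ht
  have hD0 : ∀ x, IntervalIntegrable (fun t => t ^ a * ((u x t - ℓ) * ux x t)) volume 0 Y ∧
      HasDerivAt (fun x => ∫ t in (0:ℝ)..Y, t ^ a * ((u x t - ℓ) ^ 2 / 2))
        (∫ t in (0:ℝ)..Y, t ^ a * ((u x t - ℓ) * ux x t)) x := by
    intro x
    obtain ⟨C, hC⟩ := hloc x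
    refine param_deriv (F := fun x t => t ^ a * ((u x t - ℓ) ^ 2 / 2))
      (F' := fun x t => t ^ a * ((u x t - ℓ) * ux x t)) ha ha hY.le hc0 (hc1 x) (hI0 x)
      (fun z hz t ht htY => (hC z hz t ht htY).1) fun z t ht => ?_
    refine ((((S.dx z t ht.le).sub_const ℓ).fun_pow 2).div_const 2 |>.const_mul
      (t ^ a)).congr_deriv ?_
    push_cast
    ring
  have hD1 : ∀ x, IntervalIntegrable (fun t => t ^ a * (ux x t ^ 2 + (u x t - ℓ) * uxx x t))
        volume 0 Y ∧
      HasDerivAt (fun x => ∫ t in (0:ℝ)..Y, t ^ a * ((u x t - ℓ) * ux x t))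
        (∫ t in (0:ℝ)..Y, t ^ a * (ux x t ^ 2 + (u x t - ℓ) * uxx x t)) x := by
    intro x
    obtain ⟨C, hC⟩ := hloc x
    refine param_deriv (F := fun x t => t ^ a * ((u x t - ℓ) * ux x t))
      (F' := fun x t => t ^ a * (ux x t ^ 2 + (u x t - ℓ) * uxx x t)) ha hκ1 hY.le hc1 (hc2 x)
      (hD0 x).1 (fun z hz t ht htY => (hC z hz t ht htY).2) fun z t ht => ?_
    refine ((((S.dx z t ht.le).sub_const ℓ).fun_mul (S.dxx z t ht)).const_mul
      (t ^ a)).congr_deriv ?_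
    ring
  refine ⟨_, _, ∫ t in (0:ℝ)..Y, L ^ 2 * (t ^ a + t ^ a), fun x => ?_, fun x => (hD0 x).2,
    fun x => (hD1 x).2.congr_deriv ?_⟩
  · rw [← Real.norm_eq_abs]
    refine intervalIntegral.norm_integral_le_of_norm_le hY.le
      (Eventually.of_forall fun t ht => hb0 x t ht.1) ?_
    exact ((intervalIntegral.intervalIntegrable_rpow' ha).add
      (intervalIntegral.intervalIntegrable_rpow' ha)).const_mul _
  · obtain ⟨K, hK0, hK⟩ := S.dens_bdd (R := |x| + Y + 1) (by positivity)
    have hx := abs_le.1 (le_refl |x|)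
    have hen : IntervalIntegrable (fun t => t ^ a * ux x t ^ 2 + t ^ a * uy x t ^ 2) volume 0 Y := by
      refine intble ha (q := -a) (by linarith) (C := K) ?_ hY.le fun t ht htY => ?_
      · exact (((c_rpow a).mul ((S.c_uxs x).pow 2)).add
          ((c_rpow a).mul ((c_slice S.cuy x).pow 2))).mono Ioc_subset_Ioi_self
      · obtain ⟨n1, n2⟩ := hK x ⟨by linarith [hx.1], by linarith [hx.2]⟩ t ht
          (by linarith [abs_nonneg x])
        have h1 := rpow_pos_of_pos ht a
        rw [abs_of_nonneg (by positivity)]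
        linarith
    have hbp := intervalIntegral.integral_eq_sub_of_hasDerivAt_of_tendsto hY
      (f := fun t => (u x t - ℓ) * (t ^ a * uy x t))
      (f' := fun t => (t ^ a * ux x t ^ 2 + t ^ a * uy x t ^ 2)
        - t ^ a * (ux x t ^ 2 + (u x t - ℓ) * uxx x t))
      (fa := (u x 0 - ℓ) * (-(g x))) (fb := (u x Y - ℓ) * (Y ^ a * uy x Y))
      (fun t ht => by
        refine (((S.dy x t ht.1).sub_const ℓ).fun_mul (S.q_deriv (x := x) ht.1)).congr_deriv ?_
        ring)
      (hen.sub (hD1 x).1)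
      (by
        have h1 := ((c_slice' S.cu x) 0 (show (0:ℝ) ≤ 0 from le_rfl)).tendsto.mono_left
          (nhdsWithin_mono 0 Ioi_subset_Ici_self)
        exact (h1.sub_const ℓ).mul (S.neu x))
      (by
        have h1 := (((S.dy x Y hY).sub_const ℓ).mul (S.q_deriv (x := x) hY)).continuousAt.tendsto
        exact h1.mono_left nhdsWithin_le_nhds)
    rw [intervalIntegral.integral_sub hen (hD1 x).1] at hbp
    linarith

lemma good (S : Sol a M g u ux uy uxx uxy uyy) {l : Filter ℝ} (hl : l = atTop ∨ l = atBot) {ℓ : ℝ}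
    (hlim : ∀ y, 0 ≤ y → Tendsto (fun x => u x y) l (nhds ℓ)) {Y η : ℝ} (hY : 0 < Y) (hη : 0 < η) :
    ∃ᶠ x in l, ∀ y, 0 ≤ y → y ≤ Y → |Ph a A ux uy x y - A x| ≤ η := by
  obtain ⟨E, E1, B, hB, h1, h2⟩ := S.energy hY ℓ
  have h4 : 0 < 1 + a := by linarith [S.ha]
  obtain ⟨η', hη', hηe⟩ : ∃ η' > 0, (1 + a) * η' = η := ⟨η / (1 + a), by positivity, by field_simp⟩
  have hf : ∃ᶠ x in l, ((∫ t in (0:ℝ)..Y, (t ^ a * ux x t ^ 2 + t ^ a * uy x t ^ 2))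
        - ((u x Y - ℓ) * (Y ^ a * uy x Y) + (u x 0 - ℓ) * g x)) < η' / 2 := by
    rcases hl with rfl | rfl
    · exact freq_top (by positivity) hB h1 h2
    · exact freq_bot (by positivity) hB h1 h2
  obtain ⟨G, hG⟩ := S.gbdd
  have hr : Tendsto (fun x => (u x Y - ℓ) * (Y ^ a * uy x Y) + (u x 0 - ℓ) * g x) l (nhds 0) := by
    have t1 := (hlim Y hY.le).sub_const ℓ
    have t2 := (hlim 0 le_rfl).sub_const ℓ
    rw [sub_self] at t1 t2
    have t3 : Tendsto (fun x => |u x Y - ℓ| * (Y ^ a * (580 * M / Y)) + |u x 0 - ℓ| * G) l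
        (nhds (|0| * (Y ^ a * (580 * M / Y)) + |0| * G)) :=
      (t1.abs.mul_const _).add (t2.abs.mul_const _)
    rw [abs_zero, zero_mul, zero_mul, add_zero] at t3
    refine squeeze_zero_norm (fun x => ?_) t3
    refine (abs_add_le _ _).trans ?_
    rw [abs_mul, abs_mul, abs_mul, abs_of_pos (rpow_pos_of_pos hY a)]
    have := S.uy_far (x := x) hY
    have := hG x
    have := rpow_pos_of_pos hY a
    gcongr
  refine (hf.and_eventually (hr.eventually (gt_mem_nhds (show (0:ℝ) < η' / 2 by positivity)))).mono ?_
  rintro x ⟨k1, k2⟩ y hy hyY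
  have hen : (∫ t in (0:ℝ)..Y, (t ^ a * ux x t ^ 2 + t ^ a * uy x t ^ 2)) ≤ η' := by linarith
  obtain ⟨K, hK0, hK⟩ := S.dens_bdd (R := |x| + Y + 1) (by positivity)
  have hx := abs_le.1 (le_refl |x|)
  have hnn : ∀ t, 0 < t → 0 ≤ t ^ a * ux x t ^ 2 + t ^ a * uy x t ^ 2 := by
    intro t ht
    have h1 := rpow_pos_of_pos ht a
    positivity
  have hInt : IntervalIntegrable (fun t => t ^ a * ux x t ^ 2 + t ^ a * uy x t ^ 2) volume 0 Y := by
    refine intble S.ha (q := -a) (by linarith [S.ha']) (C := K) ?_ hY.le fun t ht htY => ?_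
    · exact (((c_rpow a).mul ((S.c_uxs x).pow 2)).add
        ((c_rpow a).mul ((c_slice S.cuy x).pow 2))).mono Ioc_subset_Ioi_self
    · obtain ⟨n1, n2⟩ := hK x ⟨by linarith [hx.1], by linarith [hx.2]⟩ t ht
        (by linarith [abs_nonneg x])
      rw [abs_of_nonneg (hnn t ht)]
      linarith
  have hIntY : IntervalIntegrable (fun t => t ^ a * ux x t ^ 2 + t ^ a * uy x t ^ 2) volume 0 y :=
    hInt.mono_set (by rw [uIcc_of_le hy, uIcc_of_le hY.le]; exact Icc_subset_Icc_right hyY)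
  have m1 : ∫ t in (0:ℝ)..y, (t ^ a * ux x t ^ 2 + t ^ a * uy x t ^ 2) ≤
      ∫ t in (0:ℝ)..Y, (t ^ a * ux x t ^ 2 + t ^ a * uy x t ^ 2) := by
    refine intervalIntegral.integral_mono_interval le_rfl hy hyY ?_ hInt
    refine (ae_restrict_iff' measurableSet_Ioc).2 (Eventually.of_forall fun t ht => hnn t ht.1)
  have m2 : |∫ t in (0:ℝ)..y, (1/2) * t ^ a * (ux x t ^ 2 - uy x t ^ 2)| ≤
      ∫ t in (0:ℝ)..y, (t ^ a * ux x t ^ 2 + t ^ a * uy x t ^ 2) := by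
    rw [← Real.norm_eq_abs]
    refine intervalIntegral.norm_integral_le_of_norm_le hy
      (Eventually.of_forall fun t ht => ?_) hIntY
    have h1 := rpow_pos_of_pos ht.1 a
    rw [Real.norm_eq_abs, abs_le]
    have n1 : 0 ≤ t ^ a * ux x t ^ 2 := by positivity
    have n2 : 0 ≤ t ^ a * uy x t ^ 2 := by positivity
    constructor <;> linarith
  have e : Ph a A ux uy x y - A x =
      -((1 + a) * ∫ t in (0:ℝ)..y, (1/2) * t ^ a * (ux x t ^ 2 - uy x t ^ 2)) := by
    rw [Ph]; ring
  rw [e, abs_neg, abs_mul, abs_of_pos h4, ← hηe]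
  exact mul_le_mul_of_nonneg_left (m2.trans (m1.trans hen)) h4.le

end Sol

namespace Sol
variable {a M : ℝ} {g : ℝ → ℝ} {u ux uy uxx uxy uyy : ℝ → ℝ → ℝ} {A : ℝ → ℝ}

lemma no_min_box (S : Sol a M g u ux uy uxx uxy uyy) (hpos : ∀ x, 0 < ux x 0)
    (hA : ∀ x, HasDerivAt A (-((1 + a) * g x * ux x 0)) x) {X1 X2 Y x y : ℝ}
    (hx : x ∈ Ioo X1 X2) (hy : 0 ≤ y) (hyY : y < Y)
    (hmin : ∀ z ∈ Icc X1 X2, ∀ r ∈ Icc 0 Y, Ph a A ux uy x y ≤ Ph a A ux uy z r) : False := by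
  rcases hy.eq_or_lt with h0 | h0
  · subst h0
    refine S.no_min_bot hpos hA (x := x) (δ := Y) hyY ?_ ?_
    · filter_upwards [Icc_mem_nhds hx.1 hx.2] with z hz
      have := hmin z hz 0 ⟨le_rfl, hyY.le⟩
      rwa [Ph_zero, Ph_zero] at this
    · intro r hr hrY
      exact hmin x ⟨hx.1.le, hx.2.le⟩ r ⟨hr, hrY⟩
  · refine S.no_min_int hpos hA (x := x) h0 ?_ ?_
    · filter_upwards [Icc_mem_nhds hx.1 hx.2] with z hz using hmin z hz y ⟨hy, hyY.le⟩
    · filter_upwards [Icc_mem_nhds h0 hyY] with r hr using hmin x ⟨hx.1.le, hx.2.le⟩ r hr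

lemma top_small (S : Sol a M g u ux uy uxx uxy uyy)
    (hA : ∀ x, HasDerivAt A (-((1 + a) * g x * ux x 0)) x)
    (htop : ∀ y, 0 ≤ y → Tendsto (fun x => u x y) atTop (nhds 1))
    (hAtop : Tendsto A atTop (nhds 0)) {η : ℝ} (hη : 0 < η) :
    ∀ᶠ Y in atTop, ∀ x, |Ph a A ux uy x Y| ≤ η := by
  obtain ⟨C, hC, hosc⟩ := S.Ph_osc hA
  have hlim : Tendsto (fun Y : ℝ => C * Y ^ (a - 1)) atTop (nhds (C * 0)) := by
    have := tendsto_rpow_neg_atTop (show 0 < 1 - a by linarith [S.ha'])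
    rw [neg_sub] at this
    exact this.const_mul C
  rw [mul_zero] at hlim
  filter_upwards [hlim.eventually (gt_mem_nhds (show (0:ℝ) < η / 3 by positivity)),
    eventually_gt_atTop 0] with Y h1 hY x
  have h2 := S.good (A := A) (Or.inl rfl) htop hY (show (0:ℝ) < η / 3 by positivity)
  have h3 := hAtop.eventually (Metric.ball_mem_nhds 0 (show (0:ℝ) < η / 3 by positivity))
  obtain ⟨x', k1, k2⟩ := (h2.and_eventually h3).exists
  have k1 := k1 Y hY.le le_rfl
  rw [Real.dist_eq, sub_zero] at k2
  have k3 := hosc Y hY x x'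
  rw [abs_le] at k1 k3 ⊢
  have := abs_lt.1 k2
  constructor <;> linarith [k1.1, k1.2, k3.1, k3.2, this.1, this.2]

lemma bot_zero (S : Sol a M g u ux uy uxx uxy uyy)
    (hA : ∀ x, HasDerivAt A (-((1 + a) * g x * ux x 0)) x)
    (htop : ∀ y, 0 ≤ y → Tendsto (fun x => u x y) atTop (nhds 1))
    (hbot : ∀ y, 0 ≤ y → Tendsto (fun x => u x y) atBot (nhds (-1)))
    (hAtop : Tendsto A atTop (nhds 0)) {c : ℝ} (hAbot : Tendsto A atBot (nhds c)) : c = 0 := by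
  by_contra hc
  have hc0 : 0 < |c| := abs_pos.2 hc
  obtain ⟨Y, h1, hY⟩ := ((S.top_small hA htop hAtop (show (0:ℝ) < |c| / 4 by positivity)).and
    (eventually_gt_atTop 0)).exists
  have h2 := S.good (A := A) (Or.inr rfl) hbot hY (show (0:ℝ) < |c| / 4 by positivity)
  have h3 := hAbot.eventually (Metric.ball_mem_nhds c (show (0:ℝ) < |c| / 4 by positivity))
  obtain ⟨x', k1, k2⟩ := (h2.and_eventually h3).exists
  have k1 := abs_le.1 (k1 Y hY.le le_rfl)
  rw [Real.dist_eq] at k2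
  have k3 := abs_le.1 (h1 x')
  have k2 := abs_lt.1 k2
  have : |c| ≤ 3 * |c| / 4 := by
    nth_rw 1 [abs_le]
    constructor <;> linarith [k1.1, k1.2, k3.1, k3.2, k2.1, k2.2]
  linarith

lemma Ph_nonneg (S : Sol a M g u ux uy uxx uxy uyy) (hpos : ∀ x, 0 < ux x 0)
    (hA : ∀ x, HasDerivAt A (-((1 + a) * g x * ux x 0)) x)
    (htop : ∀ y, 0 ≤ y → Tendsto (fun x => u x y) atTop (nhds 1))
    (hbot : ∀ y, 0 ≤ y → Tendsto (fun x => u x y) atBot (nhds (-1)))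
    (hAtop : Tendsto A atTop (nhds 0)) {c : ℝ} (hAbot : Tendsto A atBot (nhds c))
    {x y : ℝ} (hy : 0 ≤ y) : 0 ≤ Ph a A ux uy x y := by
  by_contra hneg
  push Not at hneg
  have hc := S.bot_zero hA htop hbot hAtop hAbot
  rw [hc] at hAbot
  set η := -Ph a A ux uy x y / 4 with hη
  have hη0 : 0 < η := by rw [hη]; linarith
  obtain ⟨Y, h1, hY⟩ := ((S.top_small hA htop hAtop hη0).and (eventually_gt_atTop y)).exists
  have hY0 : 0 < Y := hy.trans_lt hY
  obtain ⟨X2, ⟨a1, a2⟩, a3⟩ := ((S.good (A := A) (Or.inl rfl) htop hY0 hη0).and_eventually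
    (hAtop.eventually (Metric.ball_mem_nhds 0 hη0))).and_eventually (eventually_gt_atTop x) |>.exists
  obtain ⟨X1, ⟨b1, b2⟩, b3⟩ := ((S.good (A := A) (Or.inr rfl) hbot hY0 hη0).and_eventually
    (hAbot.eventually (Metric.ball_mem_nhds 0 hη0))).and_eventually (eventually_lt_atBot x) |>.exists
  rw [Real.dist_eq, sub_zero] at a2 b2
  have a2 := abs_lt.1 a2
  have b2 := abs_lt.1 b2
  obtain ⟨⟨z, r⟩, hzr, hmin⟩ := (isCompact_Icc.prod isCompact_Icc).exists_isMinOn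
    (s := Icc X1 X2 ×ˢ Icc 0 Y) ⟨(x, y), ⟨b3.le, a3.le⟩, hy, hY.le⟩
    ((S.Ph_cont hA).mono fun p hp => hp.2.1)
  obtain ⟨hz, hr⟩ := hzr
  have hz : z ∈ Icc X1 X2 := hz
  have hr : r ∈ Icc 0 Y := hr
  have hmin' : ∀ z' ∈ Icc X1 X2, ∀ r' ∈ Icc 0 Y, Ph a A ux uy z r ≤ Ph a A ux uy z' r' :=
    fun z' hz' r' hr' => hmin (show (z', r') ∈ Icc X1 X2 ×ˢ Icc 0 Y from ⟨hz', hr'⟩)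
  have hle := hmin' x ⟨b3.le, a3.le⟩ y ⟨hy, hY.le⟩
  have hval : Ph a A ux uy x y = -(4 * η) := by rw [hη]; ring
  have n1 : X1 < z := by
    refine lt_of_le_of_ne hz.1 ?_
    rintro rfl
    have := (abs_le.1 (b1 r hr.1 hr.2)).1
    linarith [b2.1]
  have n2 : z < X2 := by
    refine lt_of_le_of_ne hz.2 ?_
    rintro rfl
    have := (abs_le.1 (a1 r hr.1 hr.2)).1
    linarith [a2.1]
  have n3 : r < Y := by
    refine lt_of_le_of_ne hr.2 ?_
    rintro rfl
    have := (abs_le.1 (h1 z)).1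
    linarith
  exact S.no_min_box hpos hA ⟨n1, n2⟩ hr.1 n3 hmin'

lemma Ph_pos (S : Sol a M g u ux uy uxx uxy uyy) (hpos : ∀ x, 0 < ux x 0)
    (hA : ∀ x, HasDerivAt A (-((1 + a) * g x * ux x 0)) x)
    (htop : ∀ y, 0 ≤ y → Tendsto (fun x => u x y) atTop (nhds 1))
    (hbot : ∀ y, 0 ≤ y → Tendsto (fun x => u x y) atBot (nhds (-1)))
    (hAtop : Tendsto A atTop (nhds 0)) {c : ℝ} (hAbot : Tendsto A atBot (nhds c))
    {x y : ℝ} (hy : 0 ≤ y) : 0 < Ph a A ux uy x y := by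
  refine lt_of_le_of_ne (S.Ph_nonneg hpos hA htop hbot hAtop hAbot hy) fun h0 => ?_
  refine S.no_min_box hpos hA (X1 := x - 1) (X2 := x + 1) (Y := y + 1) (x := x) (y := y)
    ⟨by linarith, by linarith⟩ hy (by linarith) fun z _ r hr => ?_
  rw [← h0]
  exact S.Ph_nonneg hpos hA htop hbot hAtop hAbot hr.1

end Sol

lemma path_deriv1 {E : Type*} [NormedAddCommGroup E] [NormedSpace ℝ E] {D : ℝ × ℝ → E}
    {D' : ℝ × ℝ →L[ℝ] E} {c : ℝ → ℝ × ℝ} {w : ℝ × ℝ} {t : ℝ}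
    (h : HasFDerivAt D D' (c t)) (hc : HasDerivAt c w t) :
    HasDerivAt (fun s => D (c s)) (D' w) t :=
  h.comp_hasDerivAt t hc

lemma path_deriv2 {D : ℝ × ℝ → (ℝ × ℝ →L[ℝ] ℝ)}
    {D' : ℝ × ℝ →L[ℝ] (ℝ × ℝ →L[ℝ] ℝ)} {c : ℝ → ℝ × ℝ} {w : ℝ × ℝ} {t : ℝ}
    (h : HasFDerivAt D D' (c t)) (hc : HasDerivAt c w t) (v : ℝ × ℝ) :
    HasDerivAt (fun s => D (c s) v) (D' w v) t :=
  (ContinuousLinearMap.apply ℝ ℝ v).hasFDerivAt.comp_hasDerivAt t (path_deriv1 h hc)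

lemma c2_pack {u : ℝ → ℝ → ℝ}
    (h : ContDiffOn ℝ 2 (fun p : ℝ × ℝ => u p.1 p.2) {p : ℝ × ℝ | 0 < p.2}) :
    ∃ uxx uxy uyy : ℝ → ℝ → ℝ,
      ContinuousOn (fun p : ℝ × ℝ => deriv (fun r => u p.1 r) p.2) {p : ℝ × ℝ | 0 < p.2} ∧
      ContinuousOn (fun p : ℝ × ℝ => uxx p.1 p.2) {p : ℝ × ℝ | 0 < p.2} ∧
      ContinuousOn (fun p : ℝ × ℝ => uxy p.1 p.2) {p : ℝ × ℝ | 0 < p.2} ∧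
      ∀ x y, 0 < y →
        HasDerivAt (fun x' => u x' y) (deriv (fun x' => u x' y) x) x ∧
        HasDerivAt (fun r => u x r) (deriv (fun r => u x r) y) y ∧
        HasDerivAt (fun x' => deriv (fun x' => u x' y) x') (uxx x y) x ∧
        HasDerivAt (fun r => deriv (fun x' => u x' r) x) (uxy x y) y ∧
        HasDerivAt (fun x' => deriv (fun r => u x' r) y) (uxy x y) x ∧
        HasDerivAt (fun r => deriv (fun r => u x r) r) (uyy x y) y := by
  set F : ℝ × ℝ → ℝ := fun p => u p.1 p.2 with hF
  set U : Set (ℝ × ℝ) := {p | 0 < p.2} with hU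
  have hUo : IsOpen U := isOpen_lt continuous_const continuous_snd
  have hD : ContDiffOn ℝ 1 (fderiv ℝ F) U := h.fderiv_of_isOpen hUo (by norm_num)
  have hD2 : ContinuousOn (fderiv ℝ (fderiv ℝ F)) U :=
    hD.continuousOn_fderiv_of_isOpen hUo le_rfl
  have hd : ∀ p ∈ U, HasFDerivAt F (fderiv ℝ F p) p := fun p hp =>
    ((h.contDiffAt (hUo.mem_nhds hp)).differentiableAt (by norm_num)).hasFDerivAt
  have hdd : ∀ p ∈ U, HasFDerivAt (fderiv ℝ F) (fderiv ℝ (fderiv ℝ F) p) p := fun p hp =>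
    ((hD.contDiffAt (hUo.mem_nhds hp)).differentiableAt (by norm_num)).hasFDerivAt
  have px : ∀ x y : ℝ, HasDerivAt (fun x' : ℝ => (x', y)) ((1:ℝ), (0:ℝ)) x := fun x y =>
    (hasDerivAt_id' x).prodMk (hasDerivAt_const x y)
  have py : ∀ x y : ℝ, HasDerivAt (fun r : ℝ => (x, r)) ((0:ℝ), (1:ℝ)) y := fun x y =>
    (hasDerivAt_const y x).prodMk (hasDerivAt_id' y)
  have h1 : ∀ x y, 0 < y → HasDerivAt (fun x' => u x' y) (fderiv ℝ F (x, y) (1, 0)) x :=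
    fun x y hy => path_deriv1 (D := F) (c := fun x' => (x', y)) (hd (x, y) hy) (px x y)
  have h2 : ∀ x y, 0 < y → HasDerivAt (fun r => u x r) (fderiv ℝ F (x, y) (0, 1)) y :=
    fun x y hy => path_deriv1 (D := F) (c := fun r => (x, r)) (hd (x, y) hy) (py x y)
  have k1 : ∀ x y v, 0 < y → HasDerivAt (fun x' => fderiv ℝ F (x', y) v)
      (fderiv ℝ (fderiv ℝ F) (x, y) (1, 0) v) x := fun x y v hy =>
    path_deriv2 (D := fderiv ℝ F) (c := fun x' => (x', y)) (hdd (x, y) hy) (px x y) v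
  have k2 : ∀ x y v, 0 < y → HasDerivAt (fun r => fderiv ℝ F (x, r) v)
      (fderiv ℝ (fderiv ℝ F) (x, y) (0, 1) v) y := fun x y v hy =>
    path_deriv2 (D := fderiv ℝ F) (c := fun r => (x, r)) (hdd (x, y) hy) (py x y) v
  refine ⟨fun x y => fderiv ℝ (fderiv ℝ F) (x, y) (1, 0) (1, 0),
    fun x y => fderiv ℝ (fderiv ℝ F) (x, y) (0, 1) (1, 0),
    fun x y => fderiv ℝ (fderiv ℝ F) (x, y) (0, 1) (0, 1), ?_, ?_, ?_, fun x y hy =>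
    ⟨?_, ?_, ?_, ?_, ?_, ?_⟩⟩
  · refine ContinuousOn.congr (f := fun p => fderiv ℝ F p (0, 1))
      (hD.continuousOn.clm_apply continuousOn_const) fun p hp => ?_
    exact (h2 p.1 p.2 hp).deriv
  · exact (hD2.clm_apply continuousOn_const).clm_apply continuousOn_const
  · exact (hD2.clm_apply continuousOn_const).clm_apply continuousOn_const
  · exact (h1 x y hy).differentiableAt.hasDerivAt
  · exact (h2 x y hy).differentiableAt.hasDerivAt
  · have e : (fun x' => deriv (fun x' => u x' y) x') = fun x' => fderiv ℝ F (x', y) (1, 0) :=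
      funext fun x' => (h1 x' y hy).deriv
    rw [e]
    exact k1 x y _ hy
  · refine (k2 x y (1, 0) hy).congr_of_eventuallyEq ?_
    filter_upwards [lt_mem_nhds hy] with r hr using (h1 x r hr).deriv
  · have e : (fun x' => deriv (fun r => u x' r) y) = fun x' => fderiv ℝ F (x', y) (0, 1) :=
      funext fun x' => (h2 x' y hy).deriv
    rw [e]
    have hs : IsSymmSndFDerivAt ℝ F (x, y) :=
      (h.contDiffAt (hUo.mem_nhds hy)).isSymmSndFDerivAt (by simp)
    exact (k1 x y _ hy).congr_deriv (hs.eq (1, 0) (0, 1))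
  · refine (k2 x y (0, 1) hy).congr_of_eventuallyEq ?_
    filter_upwards [lt_mem_nhds hy] with r hr using (h2 x r hr).deriv

lemma lim_window_top {v : ℝ → ℝ} {L : ℝ} (h : Tendsto v atTop (nhds L)) :
    ∀ X > 0, ∀ e > 0, ∀ᶠ x in atTop, ∀ z, |z - x| ≤ X → |v z - L| ≤ e := by
  intro X hX e he
  obtain ⟨Z, hZ⟩ := eventually_atTop.1 (h.eventually (Metric.ball_mem_nhds L he))
  filter_upwards [eventually_ge_atTop (Z + X)] with x hx z hz
  have := (abs_le.1 hz).1
  exact le_of_lt (hZ z (by linarith))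

lemma lim_window_bot {v : ℝ → ℝ} {L : ℝ} (h : Tendsto v atBot (nhds L)) :
    ∀ X > 0, ∀ e > 0, ∀ᶠ x in atBot, ∀ z, |z - x| ≤ X → |v z - L| ≤ e := by
  intro X hX e he
  obtain ⟨Z, hZ⟩ := eventually_atBot.1 (h.eventually (Metric.ball_mem_nhds L he))
  filter_upwards [eventually_le_atBot (Z - X)] with x hx z hz
  have := (abs_le.1 hz).2
  exact le_of_lt (hZ z (by linarith))

/-- The strict Hamiltonian inequality on finite intervals for layer solutions. -/
theorem statement17 (s γ a : ℝ) (hs : s ∈ Set.Ioo (0:ℝ) 1) (ha : a = 1 - 2*s)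
    (hγ : max 0 (1 - 2*s) < γ)
    (f : ℝ → ℝ) (hf : IsC1Holder γ f)
    (u : ℝ → ℝ → ℝ) (hu : IsLayerExtSolution1 a f u) :
    ∀ y : ℝ, 0 ≤ y → ∀ x : ℝ,
      (1+a) * ∫ t in (0:ℝ)..y, (1/2) * t ^ a *
          ((deriv (fun x' => u x' t) x) ^ 2 - (deriv (fun t' => u x t') t) ^ 2)
        < potG f (u x 0) - potG f 1 := by
  intro y hy x
  have ha1 : -1 < a := by rw [ha]; linarith [hs.2]
  have ha2 : a < 1 := by rw [ha]; linarith [hs.1]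
  have h1a : 0 < 1 + a := by linarith
  obtain ⟨M₀, hM₀⟩ := hu.bounded
  obtain ⟨uxx, uxy, uyy, c1, c2, c3, hd⟩ := c2_pack hu.smooth
  have hfc : Continuous f := hf.1.continuous
  have hd0 : ∀ z, HasDerivAt (fun x' => u x' 0) (deriv (fun x' => u x' 0) z) z := fun z =>
    (differentiableAt_of_deriv_ne_zero (hu.mono z).ne').hasDerivAt
  have cv0 : Continuous fun z : ℝ => deriv (fun x' => u x' 0) z := by
    have := hu.contDx.comp_continuous (f := fun z : ℝ => (z, (0:ℝ))) (by fun_prop)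
      (fun z => show (0:ℝ) ≤ 0 from le_rfl)
    exact this
  have cu0 : Continuous fun z : ℝ => u z 0 :=
    continuous_iff_continuousAt.2 fun z => (hd0 z).continuousAt
  have hdf : ∀ r, HasDerivAt f (deriv f r) r := fun r =>
    (hf.1.differentiable (by norm_num) r).hasDerivAt
  have cdf : Continuous (deriv f) := hf.1.continuous_deriv le_rfl
  have hg : ∀ z, HasDerivAt (fun z => f (u z 0) / (1 + a))
      (deriv f (u z 0) * deriv (fun x' => u x' 0) z / (1 + a)) z := fun z =>
    ((hdf (u z 0)).comp z (hd0 z)).div_const (1 + a)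
  have cg : Continuous fun z => deriv f (u z 0) * deriv (fun x' => u x' 0) z / (1 + a) :=
    ((cdf.comp cu0).mul cv0).div_const _
  have S : Sol a (|M₀| + 1) (fun z => f (u z 0) / (1 + a)) u
      (fun z t => deriv (fun x' => u x' t) z) (fun z t => deriv (fun r => u z r) t)
      uxx uxy uyy := by
    refine ⟨ha1, ha2, by positivity, ?_, hu.cont, hu.contDx, c1, c2, c3, ?_,
      fun z t ht => (hd z t ht).2.1, fun z t ht => (hd z t ht).2.2.1,
      fun z t ht => (hd z t ht).2.2.2.1, fun z t ht => (hd z t ht).2.2.2.2.1,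
      fun z t ht => (hd z t ht).2.2.2.2.2, ?_, ?_, ?_, ?_⟩
    · intro z t ht
      linarith [hM₀ z t ht, le_abs_self M₀]
    · intro z t ht
      rcases ht.eq_or_lt with h | h
      · subst h; exact hd0 z
      · exact (hd z t h).1
    · intro z t ht
      have := hu.eqn z t ht
      rw [(hd z t ht).2.2.1.deriv, (hd z t ht).2.2.2.2.2.deriv] at this
      exact this
    · intro z
      have := (hu.neumann z).const_mul (-(1 + a)⁻¹)
      refine (this.congr fun t => ?_).trans (le_of_eq ?_)
      · field_simp
      · congr 1
        field_simp
    · intro R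
      obtain ⟨K, hK⟩ := (isCompact_Icc (a := -R) (b := R)).exists_bound_of_continuousOn
        cg.continuousOn
      refine ⟨|K|, abs_nonneg _, fun z hz w hw => ?_⟩
      have := Convex.norm_image_sub_le_of_norm_hasDerivWithin_le
        (fun q _ => (hg q).hasDerivWithinAt) (fun q hq => (hK q hq).trans (le_abs_self K))
        (convex_Icc (-R) R) hw hz
      simpa only [Real.norm_eq_abs] using this
    · obtain ⟨K, hK⟩ := (isCompact_Icc (a := -M₀) (b := M₀)).exists_bound_of_continuousOn
        (f := fun r => f r / (1 + a)) (hfc.div_const _).continuousOn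
      exact ⟨K, fun z => hK _ (abs_le.1 (hM₀ z 0 le_rfl))⟩
  have hG : ∀ r, HasDerivAt (potG f) (-f r) r := fun r =>
    (intervalIntegral.integral_hasDerivAt_right (hfc.intervalIntegrable _ _)
      (hfc.stronglyMeasurableAtFilter _ _) hfc.continuousAt).neg
  have cG : Continuous (potG f) := continuous_iff_continuousAt.2 fun r => (hG r).continuousAt
  have key := S.Ph_pos (A := fun z => potG f (u z 0) - potG f 1) (c := potG f (-1) - potG f 1)
    hu.mono ?_ (fun t ht => S.lim_u (lim_window_top hu.limPos) ht)
    (fun t ht => S.lim_u (lim_window_bot hu.limNeg) ht) ?_ ?_ (x := x) hy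
  · unfold Ph at key
    linarith
  · intro z
    refine (((hG (u z 0)).comp z (hd0 z)).sub_const (potG f 1)).congr_deriv ?_
    field_simp
  · have := ((cG.tendsto 1).comp hu.limPos).sub_const (potG f 1)
    rw [sub_self] at this
    exact this
  · exact ((cG.tendsto (-1)).comp hu.limNeg).sub_const (potG f 1)
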